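/- arXiv:2405.01123 — 9 statements merged into one kernel-verified Lean document; each statement's English description precedes it below -/
import Mathlib

section
/- Let (X,d) be a complete metric space and let φ : X → [0,+∞] be lower semicontinuous on X with dom φ = φ⁻¹([0,+∞)) nonempty. Suppose there exists κ > 0 such that for every x ∈ X with φ(x) > 0 there exists x̂ ∈ X \ {x} with φ(x̂) + κ·d(x,x̂) ≤ φ(x) (Caristi-type condition). Then for every x₀ ∈ X there exists x_κ ∈ X such that φ(x_κ) = 0 and d(x_κ,x₀) ≤ φ(x₀)/κ; in particular dist(x₀, [φ ≤ 0]) ≤ φ(x₀)/κ. -/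
open Set Metric EMetric ENNReal Pointwise Filter Topology

/-- Excess of `A` beyond `B`: `e(A,B) = ⨆ a ∈ A, dist(a,B)` in `[0,∞]`. -/
noncomputable def excess {Y : Type*} [PseudoEMetricSpace Y] (A B : Set Y) : ℝ≥0∞ :=
  ⨆ a ∈ A, EMetric.infEdist a B

/-- `C` is a closed convex cone (containing the origin). -/
def IsClosedConvexCone {Y : Type*} [SeminormedAddCommGroup Y] [NormedSpace ℝ Y]
    (C : Set Y) : Prop :=
  IsClosed C ∧ Convex ℝ C ∧ (0 : Y) ∈ C ∧ ∀ c ∈ C, ∀ t : ℝ, 0 ≤ t → t • c ∈ C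

/-- `a` is an admissible bound of metric `C`-increase of `G` at `x₀`. -/
def IsIncBoundAt {X Y : Type*} [PseudoMetricSpace X] [SeminormedAddCommGroup Y]
    (G : X → Set Y) (C : Set Y) (x₀ : X) (a : ℝ) : Prop :=
  1 < a ∧ ∃ δ : ℝ, 0 < δ ∧ ∀ r : ℝ, 0 < r → r ≤ δ →
    ∃ u ∈ Metric.closedBall x₀ r,
      Metric.cthickening (a * r) (G u) ⊆ Metric.cthickening r (G x₀ + C)

/-- `G` is metrically `C`-increasing at `x₀`. -/
def CIncreasingAt {X Y : Type*} [PseudoMetricSpace X] [SeminormedAddCommGroup Y]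
    (G : X → Set Y) (C : Set Y) (x₀ : X) : Prop :=
  ∃ a : ℝ, IsIncBoundAt G C x₀ a

/-- The exact bound of metric `C`-increase of `G` at `x₀` (in `[0,∞]`). -/
noncomputable def incBound {X Y : Type*} [PseudoMetricSpace X] [SeminormedAddCommGroup Y]
    (G : X → Set Y) (C : Set Y) (x₀ : X) : ℝ≥0∞ :=
  ⨆ a ∈ {a : ℝ | IsIncBoundAt G C x₀ a}, ENNReal.ofReal a

/-- Lower semicontinuity of a set-valued mapping. -/
def LscSV {P Y : Type*} [TopologicalSpace P] [TopologicalSpace Y] (G : P → Set Y) : Prop :=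
  ∀ p : P, ∀ A : Set Y, IsOpen A → (G p ∩ A).Nonempty →
    ∀ᶠ p' in nhds p, (G p' ∩ A).Nonempty

/-- Upper semicontinuity of a set-valued mapping. -/
def UscSV {P Y : Type*} [TopologicalSpace P] [TopologicalSpace Y] (G : P → Set Y) : Prop :=
  ∀ p : P, ∀ A : Set Y, IsOpen A → G p ⊆ A → ∀ᶠ p' in nhds p, G p' ⊆ A

/-- Hausdorff `C`-upper semicontinuity at a point. -/
def HausdorffCUscAt {P Y : Type*} [TopologicalSpace P] [SeminormedAddCommGroup Y]
    (G : P → Set Y) (C : Set Y) (p₀ : P) : Prop :=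
  ∀ ε : ℝ, 0 < ε → ∀ᶠ p in nhds p₀, G p ⊆ Metric.cthickening ε (G p₀ + C)

/-- `C`-concavity of a set-valued mapping. -/
def CConcave {X Y : Type*} [SeminormedAddCommGroup X] [NormedSpace ℝ X]
    [SeminormedAddCommGroup Y] [NormedSpace ℝ Y] (G : X → Set Y) (C : Set Y) : Prop :=
  ∀ x₁ x₂ : X, ∀ t : ℝ, t ∈ Set.Icc (0:ℝ) 1 →
    G (t • x₁ + (1 - t) • x₂) ⊆ t • G x₁ + (1 - t) • G x₂ + C

/-- A set is proximinal if the distance to it is attained from every point. -/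
def Proximinal {X : Type*} [PseudoMetricSpace X] (S : Set X) : Prop :=
  ∀ x : X, ∃ s ∈ S, dist x s = Metric.infDist x S

/-- Metric (Menger) convexity of a metric space. -/
def MetricallyConvex (X : Type*) [PseudoMetricSpace X] : Prop :=
  ∀ a b : X, a ≠ b → ∃ c : X, c ≠ a ∧ c ≠ b ∧ dist a b = dist a c + dist c b

/-- The constant `α_{F,C}` associated with a parameterized set-valued inclusion. -/
noncomputable def alphaFC {P X Y : Type*} [PseudoMetricSpace X] [SeminormedAddCommGroup Y]
    (F : P → X → Set Y) (Cm : P → Set Y) : ℝ≥0∞ :=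
  ⨅ q ∈ {q : P × X | ¬ (F q.1 q.2 ⊆ Cm q.1)}, incBound (F q.1) (Cm q.1) q.2

/-- The constant `α̃_{F,C,R}` associated with a constrained set-valued inclusion. -/
noncomputable def alphaTilde {P X Y : Type*} [PseudoMetricSpace X] [SeminormedAddCommGroup Y]
    (F : P → X → Set Y) (Cm : P → Set Y) (R : P → Set X) : ℝ≥0∞ :=
  ⨅ q ∈ {q : P × X | ¬ (F q.1 q.2 ⊆ Cm q.1) ∧ q.2 ∈ R q.1}, incBound (F q.1) (Cm q.1) q.2

/-- The exact bound of `C`-decrease of a single-valued map: `dec(g,C,x₀) = inc(−g,C,x₀)`. -/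
noncomputable def decBound {X Y : Type*} [PseudoMetricSpace X] [SeminormedAddCommGroup Y]
    (g : X → Y) (C : Set Y) (x₀ : X) : ℝ≥0∞ :=
  incBound (fun x => ({-g x} : Set Y)) C x₀

/-- `g` is `C`-decreasing at `x₀` iff `−g` is `C`-increasing there. -/
def CDecreasingAt {X Y : Type*} [PseudoMetricSpace X] [SeminormedAddCommGroup Y]
    (g : X → Y) (C : Set Y) (x₀ : X) : Prop :=
  CIncreasingAt (fun x => ({-g x} : Set Y)) C x₀

/-- The Ekeland section of `φ` at `x`: the points that `x` dominates in the Bishop–Phelps order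
with slope `c`. -/
def ekelandSection {X : Type*} [PseudoEMetricSpace X] (φ : X → ℝ≥0∞) (c : ℝ≥0∞) (x : X) : Set X :=
  {y | φ y + c * edist x y ≤ φ x}

theorem self_mem_ekelandSection {X : Type*} [PseudoEMetricSpace X] (φ : X → ℝ≥0∞) (c : ℝ≥0∞)
    (x : X) : x ∈ ekelandSection φ c x := by
  simp [ekelandSection]

theorem ekelandSection_trans {X : Type*} [PseudoEMetricSpace X] {φ : X → ℝ≥0∞} {c : ℝ≥0∞}
    {x y z : X} (hy : y ∈ ekelandSection φ c x) (hz : z ∈ ekelandSection φ c y) :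
    z ∈ ekelandSection φ c x :=
  calc φ z + c * edist x z ≤ φ z + c * (edist x y + edist y z) := by
        gcongr; exact edist_triangle x y z
    _ = (φ z + c * edist y z) + c * edist x y := by ring
    _ ≤ φ y + c * edist x y := by gcongr; exact hz
    _ ≤ φ x := hy

theorem isClosed_ekelandSection {X : Type*} [PseudoEMetricSpace X] {φ : X → ℝ≥0∞} {c : ℝ≥0∞}
    (hφ : LowerSemicontinuous φ) (hc : c ≠ ⊤) (x : X) : IsClosed (ekelandSection φ c x) := by
  have hcont : Continuous fun y => c * edist x y :=
    (ENNReal.continuous_const_mul hc).comp (continuous_const.edist continuous_id)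
  exact (hφ.add hcont.lowerSemicontinuous).isClosed_preimage (φ x)

theorem edist_le_of_mem_ekelandSection {X : Type*} [PseudoEMetricSpace X] {φ : X → ℝ≥0∞}
    {c ε : ℝ≥0∞} (hc₀ : c ≠ 0) (hc : c ≠ ⊤) {x y : X} (hx : φ x ≠ ⊤)
    (hy : y ∈ ekelandSection φ c x) (hε : φ x ≤ φ y + ε) : edist x y ≤ ε / c := by
  have hle : φ y + c * edist x y ≤ φ x := hy
  have hφy : φ y ≠ ⊤ := ne_top_of_le_ne_top hx (le_self_add.trans hle)
  rw [ENNReal.le_div_iff_mul_le (Or.inl hc₀) (Or.inl hc), mul_comm]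
  exact (ENNReal.add_le_add_iff_left hφy).1 (hle.trans hε)

/-- An approximate minimizer of `φ` on an Ekeland section. -/
theorem exists_mem_ekelandSection_forall_le {X : Type*} [PseudoEMetricSpace X] (φ : X → ℝ≥0∞)
    (c : ℝ≥0∞) {ε : ℝ≥0∞} (hε : ε ≠ 0) (x : X) :
    ∃ y ∈ ekelandSection φ c x, ∀ z ∈ ekelandSection φ c x, φ y ≤ φ z + ε := by
  by_cases hm : (⨅ z ∈ ekelandSection φ c x, φ z) = ⊤
  · refine ⟨x, self_mem_ekelandSection φ c x, fun z hz => ?_⟩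
    simp only [iInf_eq_top] at hm
    simp [hm z hz]
  · have hlt := ENNReal.lt_add_right hm hε
    obtain ⟨y, hlt⟩ := iInf_lt_iff.1 hlt
    obtain ⟨hy, hlt⟩ := iInf_lt_iff.1 hlt
    exact ⟨y, hy, fun z hz => hlt.le.trans (by gcongr; exact iInf₂_le z hz)⟩

/-- Ekeland's variational principle: every section at a point of finite value contains a point
whose own section is trivial. -/
theorem exists_mem_ekelandSection_eq_singleton {X : Type*} [EMetricSpace X] [CompleteSpace X]
    {φ : X → ℝ≥0∞} (hφ : LowerSemicontinuous φ) {c : ℝ≥0∞} (hc₀ : c ≠ 0) (hc : c ≠ ⊤) {x₀ : X}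
    (hx₀ : φ x₀ ≠ ⊤) : ∃ a ∈ ekelandSection φ c x₀, ekelandSection φ c a = {a} := by
  have hpow (n : ℕ) : (1 / 2 ^ n : ℝ≥0∞) ≠ 0 := by simp
  choose next hnext_mem hnext_le using
    fun n => exists_mem_ekelandSection_forall_le φ c (hpow n)
  let u : ℕ → X := fun n => Nat.rec x₀ next n
  have hu_succ (n : ℕ) : u (n + 1) ∈ ekelandSection φ c (u n) := hnext_mem n (u n)
  have hu_mem (m k : ℕ) : u (m + k) ∈ ekelandSection φ c (u m) := by
    induction k with
    | zero => exact self_mem_ekelandSection φ c (u m)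
    | succ k ih => exact ekelandSection_trans ih (hu_succ (m + k))
  have hu_top (n : ℕ) : φ (u n) ≠ ⊤ := by
    have h : u n ∈ ekelandSection φ c x₀ := Nat.zero_add n ▸ hu_mem 0 n
    exact ne_top_of_le_ne_top hx₀ (le_self_add.trans h)
  have hu_edist (n : ℕ) {y : X} (hy : y ∈ ekelandSection φ c (u (n + 1))) :
      edist (u (n + 1)) y ≤ 1 / 2 ^ n / c :=
    edist_le_of_mem_ekelandSection hc₀ hc (hu_top (n + 1)) hy
      (hnext_le n (u n) y (ekelandSection_trans (hu_succ n) hy))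
  have hdiv (n : ℕ) : (1 / 2 ^ n / c : ℝ≥0∞) = c⁻¹ / 2 ^ n := by
    simp only [div_eq_mul_inv, one_mul, mul_comm]
  have hcauchy : CauchySeq fun n => u (n + 1) :=
    cauchySeq_of_edist_le_geometric_two c⁻¹ (ENNReal.inv_ne_top.2 hc₀)
      fun n => (hu_edist n (hu_succ (n + 1))).trans_eq (hdiv n)
  obtain ⟨a, ha⟩ := cauchySeq_tendsto_of_complete hcauchy
  have ha' : Tendsto u atTop (𝓝 a) := (tendsto_add_atTop_iff_nat 1).1 ha
  have ha_mem (m : ℕ) : a ∈ ekelandSection φ c (u m) := by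
    refine (isClosed_ekelandSection hφ hc (u m)).mem_of_tendsto ha' ?_
    filter_upwards [eventually_ge_atTop m] with n hn
    simpa [Nat.add_sub_cancel' hn] using hu_mem m (n - m)
  refine ⟨a, ha_mem 0, Subset.antisymm (fun y hy => ?_)
    (singleton_subset_iff.2 (self_mem_ekelandSection φ c a))⟩
  have hbound : Tendsto (fun n : ℕ => c⁻¹ / 2 ^ n) atTop (𝓝 0) := by
    have h := ENNReal.Tendsto.const_mul (a := c⁻¹)
      (ENNReal.tendsto_pow_atTop_nhds_zero_of_lt_one (r := 2⁻¹) (by simp))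
      (Or.inr (ENNReal.inv_ne_top.2 hc₀))
    simpa [div_eq_mul_inv, ENNReal.inv_pow] using h
  have hy_lim : Tendsto (fun n => u (n + 1)) atTop (𝓝 y) := by
    rw [tendsto_iff_edist_tendsto_0]
    exact tendsto_of_tendsto_of_tendsto_of_le_of_le tendsto_const_nhds hbound
      (fun _ => zero_le)
      fun n => (hu_edist n (ekelandSection_trans (ha_mem (n + 1)) hy)).trans_eq (hdiv n)
  exact tendsto_nhds_unique hy_lim ha

/-- Caristi-type condition implies existence of zeros with the Bishop–Phelps/Ekeland
distance estimate. -/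
theorem stmt0 {X : Type*} [MetricSpace X] [CompleteSpace X]
    (φ : X → ℝ≥0∞) (hφlsc : LowerSemicontinuous φ)
    (hdom : {x : X | φ x ≠ ⊤}.Nonempty)
    (κ : ℝ) (hκ : 0 < κ)
    (hCaristi : ∀ x : X, 0 < φ x → ∃ xhat : X, xhat ≠ x ∧
      φ xhat + ENNReal.ofReal (κ * dist x xhat) ≤ φ x) :
    ∀ x₀ : X,
      (∃ xkappa : X, φ xkappa = 0 ∧ edist xkappa x₀ ≤ φ x₀ / ENNReal.ofReal κ) ∧
      EMetric.infEdist x₀ {x : X | φ x ≤ 0} ≤ φ x₀ / ENNReal.ofReal κ := by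
  have hc₀ : ENNReal.ofReal κ ≠ 0 := by simpa using hκ
  have hc : ENNReal.ofReal κ ≠ ⊤ := ENNReal.ofReal_ne_top
  have hfinite : ∀ x : X, φ x ≠ ⊤ →
      ∃ a : X, φ a = 0 ∧ edist a x ≤ φ x / ENNReal.ofReal κ := by
    intro x hx
    obtain ⟨a, ha, ha_eq⟩ := exists_mem_ekelandSection_eq_singleton hφlsc hc₀ hc hx
    have ha₀ : φ a = 0 := by
      by_contra hne
      obtain ⟨y, hya, hy⟩ := hCaristi a (pos_iff_ne_zero.2 hne)
      rw [ENNReal.ofReal_mul hκ.le, ← edist_dist] at hy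
      have hmem : y ∈ ekelandSection φ (ENNReal.ofReal κ) a := hy
      rw [ha_eq] at hmem
      exact hya hmem
    refine ⟨a, ha₀, ?_⟩
    rw [edist_comm]
    exact edist_le_of_mem_ekelandSection hc₀ hc hx ha (by simp [ha₀])
  intro x₀
  have hzero : ∃ a : X, φ a = 0 ∧ edist a x₀ ≤ φ x₀ / ENNReal.ofReal κ := by
    by_cases hx₀ : φ x₀ = ⊤
    · obtain ⟨x, hx⟩ := hdom
      obtain ⟨a, ha, -⟩ := hfinite x hx
      exact ⟨a, ha, by simp [hx₀, ENNReal.top_div_of_ne_top hc]⟩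
    · exact hfinite x₀ hx₀
  refine ⟨hzero, ?_⟩
  obtain ⟨a, ha, hdist⟩ := hzero
  exact (Metric.infEDist_le_edist_of_mem (s := {x : X | φ x ≤ 0}) ha.le).trans
    (by rwa [edist_comm])
end

section
/- Let P be a topological space, Y a normed vector space, and C ⊆ Y a closed convex cone with {0} ≠ C ⊊ Y. If a set-valued mapping G : P ⇉ Y with nonempty values is Hausdorff C-u.s.c. at p₀ ∈ dom G, then the function p ↦ e(G(p), C) is upper semicontinuous at p₀. -/
open Set Metric EMetric ENNReal Pointwise Filter Topology

theorem IsClosedConvexCone.add_mem {Y : Type*} [SeminormedAddCommGroup Y] [NormedSpace ℝ Y]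
    {C : Set Y} (hC : IsClosedConvexCone C) {x y : Y} (hx : x ∈ C) (hy : y ∈ C) :
    x + y ∈ C := by
  obtain ⟨-, hconv, -, hsmul⟩ := hC
  have hmid : (1 / 2 : ℝ) • x + (1 / 2 : ℝ) • y ∈ C :=
    hconv hx hy (by norm_num) (by norm_num) (by norm_num)
  have h := hsmul _ hmid 2 (by norm_num)
  rwa [smul_add, smul_smul, smul_smul, mul_one_div_cancel two_ne_zero, one_smul, one_smul] at h

/-- Translating a point by an element of a convex cone does not increase its distance to the
cone. -/
theorem IsClosedConvexCone.infEDist_add_le {Y : Type*} [SeminormedAddCommGroup Y]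
    [NormedSpace ℝ Y] {C : Set Y} (hC : IsClosedConvexCone C) (x : Y) {c : Y} (hc : c ∈ C) :
    infEDist (x + c) C ≤ infEDist x C := by
  refine le_infEDist.2 fun d hd => ?_
  rw [← edist_add_right x d c]
  exact infEDist_le_edist_of_mem (hC.add_mem hd hc)

theorem infEDist_le_excess {Y : Type*} [PseudoEMetricSpace Y] {A B : Set Y} {a : Y}
    (ha : a ∈ A) : infEDist a B ≤ excess A B :=
  le_iSup₂ (f := fun a (_ : a ∈ A) => infEDist a B) a ha

/-- Enlarging `S + C` by `ε < r` raises the excess of `S` beyond the cone `C` by at most `r`. -/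
theorem IsClosedConvexCone.excess_le_of_subset_cthickening {Y : Type*}
    [SeminormedAddCommGroup Y] [NormedSpace ℝ Y] {C : Set Y} (hC : IsClosedConvexCone C)
    {A S : Set Y} {ε : ℝ} {r : ℝ≥0∞} (hε : ENNReal.ofReal ε < r)
    (hA : A ⊆ Metric.cthickening ε (S + C)) : excess A C ≤ excess S C + r := by
  refine iSup₂_le fun y hy => ?_
  obtain ⟨z, ⟨s, hs, c, hc, rfl⟩, hz⟩ :=
    infEDist_lt_iff.1 ((Metric.mem_cthickening_iff.1 (hA hy)).trans_lt hε)
  calc infEDist y C ≤ infEDist (s + c) C + edist y (s + c) := infEDist_le_infEDist_add_edist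
    _ ≤ excess S C + r :=
      add_le_add ((hC.infEDist_add_le s hc).trans (infEDist_le_excess hs)) hz.le

/-- Hausdorff `C`-u.s.c. of `G` at `p₀` implies upper semicontinuity of `p ↦ e(G(p),C)`
at `p₀`. -/
theorem stmt1 {P Y : Type*} [TopologicalSpace P]
    [NormedAddCommGroup Y] [NormedSpace ℝ Y]
    (C : Set Y) (hC : IsClosedConvexCone C) (hCne : ({0} : Set Y) ≠ C)
    (hCpr : C ≠ Set.univ)
    (G : P → Set Y) (hGne : ∀ p, (G p).Nonempty)
    (p₀ : P) (husc : HausdorffCUscAt G C p₀) :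
    UpperSemicontinuousAt (fun p => excess (G p) C) p₀ := by
  intro b hb
  obtain ⟨r, hr, hrb⟩ := ENNReal.lt_iff_exists_add_pos_lt.1 hb
  have hr' : (0 : ℝ) < r := hr
  filter_upwards [husc (r / 2) (half_pos hr')] with p hp
  refine (hC.excess_le_of_subset_cthickening ?_ hp).trans_lt hrb
  rw [← ENNReal.ofReal_coe_nnreal]
  exact (ENNReal.ofReal_lt_ofReal_iff hr').2 (half_lt_self hr')
end

section
/- Let λ > 0, θ ∈ ℝ, and let O_θ denote the 2×2 rotation matrix with rows (cos θ, −sin θ) and (sin θ, cos θ), acting on ℝ² with the Euclidean norm. Then for every x ∈ ℝ² and every r > 0, the point u = x + O_{π/4−θ}(r,0) satisfies ‖u−x‖ = r (so u lies in the closed ball B(x,r)) and B(λO_θ u, (λ/√2 + 1)·r) ⊆ B(λO_θ x + ℝ²₊, r). In particular, for λ > 0 with λ/√2 + 1 > 1, the linear map x ↦ λO_θ x is ℝ²₊-increasing at every x ∈ ℝ² with inc(λO_θ, ℝ²₊, x) ≥ λ/√2 + 1. -/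
open Set Metric EMetric ENNReal Pointwise Filter Topology

/-- Rotation of the plane by angle `θ` (Euclidean structure). -/
noncomputable def rot2 (θ : ℝ) (v : EuclideanSpace ℝ (Fin 2)) : EuclideanSpace ℝ (Fin 2) :=
  (WithLp.equiv 2 (Fin 2 → ℝ)).symm
    ![Real.cos θ * v 0 - Real.sin θ * v 1, Real.sin θ * v 0 + Real.cos θ * v 1]

/-- The nonnegative orthant of the Euclidean plane. -/
def pos2 : Set (EuclideanSpace ℝ (Fin 2)) := {v | 0 ≤ v 0 ∧ 0 ≤ v 1}

theorem rot2_add (θ : ℝ) (v w : EuclideanSpace ℝ (Fin 2)) :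
    rot2 θ (v + w) = rot2 θ v + rot2 θ w := by
  ext i
  fin_cases i <;> simp [rot2] <;> ring

theorem rot2_rot2 (θ η : ℝ) (v : EuclideanSpace ℝ (Fin 2)) :
    rot2 θ (rot2 η v) = rot2 (θ + η) v := by
  ext i
  fin_cases i <;> simp [rot2, Real.cos_add, Real.sin_add] <;> ring

theorem norm_rot2 (θ : ℝ) (v : EuclideanSpace ℝ (Fin 2)) : ‖rot2 θ v‖ = ‖v‖ := by
  rw [EuclideanSpace.norm_eq, EuclideanSpace.norm_eq]
  congr 1
  simp only [Fin.sum_univ_two, Real.norm_eq_abs, sq_abs]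
  simp only [rot2, WithLp.equiv_symm_apply, Matrix.cons_val_zero, Matrix.cons_val_one]
  linear_combination (v 0 ^ 2 + v 1 ^ 2) * Real.sin_sq_add_cos_sq θ

theorem norm_axis {r : ℝ} (hr : 0 ≤ r) :
    ‖(WithLp.equiv 2 (Fin 2 → ℝ)).symm ![r, 0]‖ = r := by
  simp [EuclideanSpace.norm_eq, Real.sqrt_sq hr]

/-- Pushing a point by `s * r` along both axes makes the ball of radius `(s + 1) * r` around it
fit into the `r`-enlargement of the translated orthant. -/
theorem cthickening_subset_cthickening_add_pos2 {s r : ℝ} (hs : 0 ≤ s) (hr : 0 ≤ r)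
    {p c : EuclideanSpace ℝ (Fin 2)} (h : ∀ i, c i = p i + s * r) :
    Metric.cthickening ((s + 1) * r) ({c} : Set (EuclideanSpace ℝ (Fin 2))) ⊆
      Metric.cthickening r ({p} + pos2) := by
  intro y hy
  have hs1 : 0 < s + 1 := by linarith
  rw [cthickening_singleton _ (by positivity), Metric.mem_closedBall, dist_eq_norm] at hy
  have hcoord (i : Fin 2) : 0 ≤ s * r + s / (s + 1) * (y i - c i) := by
    have h1 : |y i - c i| ≤ (s + 1) * r := (PiLp.norm_apply_le (y - c) i).trans hy
    have h2 : s / (s + 1) * (-((s + 1) * r)) ≤ s / (s + 1) * (y i - c i) :=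
      mul_le_mul_of_nonneg_left (abs_le.mp h1).1 (by positivity)
    have h3 : s / (s + 1) * (-((s + 1) * r)) = -(s * r) := by field_simp
    linarith
  refine mem_cthickening_of_dist_le y (c + (s / (s + 1)) • (y - c)) r _ ?_ ?_
  · refine Set.mem_add.mpr ⟨p, rfl, c + (s / (s + 1)) • (y - c) - p, ⟨?_, ?_⟩, by abel⟩
    · have := hcoord 0
      simp only [PiLp.sub_apply, PiLp.add_apply, PiLp.smul_apply, smul_eq_mul, h] at this ⊢
      linarith
    · have := hcoord 1
      simp only [PiLp.sub_apply, PiLp.add_apply, PiLp.smul_apply, smul_eq_mul, h] at this ⊢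
      linarith
  · have h1 : y - (c + (s / (s + 1)) • (y - c)) = (1 / (s + 1)) • (y - c) := by
      have h2 : 1 / (s + 1) = 1 - s / (s + 1) := by field_simp; ring
      rw [h2, sub_smul, one_smul]
      abel
    rw [dist_eq_norm, h1, norm_smul, Real.norm_of_nonneg (by positivity), one_div,
      inv_mul_le_iff₀ hs1]
    exact hy

theorem smul_rot2_add_axis_apply (lam θ r : ℝ) (x : EuclideanSpace ℝ (Fin 2)) (i : Fin 2) :
    (lam • rot2 θ
      (x + rot2 (Real.pi / 4 - θ) ((WithLp.equiv 2 (Fin 2 → ℝ)).symm ![r, 0]))) i =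
      (lam • rot2 θ x) i + lam / Real.sqrt 2 * r := by
  have h2 : Real.sqrt 2 / 2 = 1 / Real.sqrt 2 := by rw [Real.sqrt_div_self, one_div]
  rw [rot2_add, rot2_rot2, add_sub_cancel]
  fin_cases i <;> simp [rot2, h2] <;> ring

/-- Rescaled rotations `λO_θ` of the Euclidean plane are `ℝ²₊`-increasing at every
point, with exact bound of increase at least `λ/√2 + 1`, the key inclusion being
witnessed by `u = x + O_{π/4−θ}(r,0)`. -/
theorem stmt5 (lam θ : ℝ) (hlam : 0 < lam) :
    (∀ (x : EuclideanSpace ℝ (Fin 2)) (r : ℝ), 0 < r →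
      ‖x + rot2 (Real.pi / 4 - θ) ((WithLp.equiv 2 (Fin 2 → ℝ)).symm ![r, 0]) - x‖ = r ∧
      x + rot2 (Real.pi / 4 - θ) ((WithLp.equiv 2 (Fin 2 → ℝ)).symm ![r, 0]) ∈
        Metric.closedBall x r ∧
      Metric.cthickening ((lam / Real.sqrt 2 + 1) * r)
          ({lam • rot2 θ
              (x + rot2 (Real.pi / 4 - θ) ((WithLp.equiv 2 (Fin 2 → ℝ)).symm ![r, 0]))} :
            Set (EuclideanSpace ℝ (Fin 2))) ⊆
        Metric.cthickening r ({lam • rot2 θ x} + pos2)) ∧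
    (1 < lam / Real.sqrt 2 + 1 ∧
      ∀ x : EuclideanSpace ℝ (Fin 2),
        CIncreasingAt (fun z => ({lam • rot2 θ z} : Set (EuclideanSpace ℝ (Fin 2)))) pos2 x ∧
        ENNReal.ofReal (lam / Real.sqrt 2 + 1) ≤
          incBound (fun z => ({lam • rot2 θ z} : Set (EuclideanSpace ℝ (Fin 2)))) pos2 x) := by
  have hs : 0 < lam / Real.sqrt 2 := by positivity
  have key (x : EuclideanSpace ℝ (Fin 2)) (r : ℝ) (hr : 0 < r) :
      ‖x + rot2 (Real.pi / 4 - θ) ((WithLp.equiv 2 (Fin 2 → ℝ)).symm ![r, 0]) - x‖ = r := by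
    rw [add_sub_cancel_left, norm_rot2, norm_axis hr.le]
  have hincl (x : EuclideanSpace ℝ (Fin 2)) (r : ℝ) (hr : 0 < r) :=
    cthickening_subset_cthickening_add_pos2 hs.le hr.le (smul_rot2_add_axis_apply lam θ r x)
  have hmem (x : EuclideanSpace ℝ (Fin 2)) (r : ℝ) (hr : 0 < r) :
      x + rot2 (Real.pi / 4 - θ) ((WithLp.equiv 2 (Fin 2 → ℝ)).symm ![r, 0]) ∈
        Metric.closedBall x r := by
    rw [Metric.mem_closedBall, dist_eq_norm, key x r hr]
  have hbound (x : EuclideanSpace ℝ (Fin 2)) :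
      IsIncBoundAt (fun z => ({lam • rot2 θ z} : Set (EuclideanSpace ℝ (Fin 2)))) pos2 x
        (lam / Real.sqrt 2 + 1) :=
    ⟨by linarith, 1, one_pos, fun r hr _ => ⟨_, hmem x r hr, hincl x r hr⟩⟩
  refine ⟨fun x r hr => ⟨key x r hr, hmem x r hr, hincl x r hr⟩, by linarith,
    fun x => ⟨⟨_, hbound x⟩, ?_⟩⟩
  exact le_iSup₂ (f := fun a (_ : a ∈ {a : ℝ | IsIncBoundAt _ pos2 x a}) => ENNReal.ofReal a)
    _ (hbound x)
end

section
/- Let G : ℝ ⇉ ℝ² be defined by G(x) = {y = (y₁,y₂) ∈ ℝ² : min{y₁,y₂} = x}, where ℝ² carries the Euclidean norm. Then for every x ∈ ℝ and every r > 0, the point u = x + r belongs to B(x,r) and B(G(u), 2r) ⊆ B(G(x) + ℝ²₊, r). Consequently G is ℝ²₊-increasing at every x ∈ ℝ with inc(G, ℝ²₊, x) ≥ 2. -/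
open Set Metric EMetric ENNReal Pointwise Filter Topology

/-- Adding the nonnegative orthant to `{min = x}` covers `{x ≤ y 0, x ≤ y 1}`. -/
theorem mem_min_level_add_pos2 {x : ℝ} {w : EuclideanSpace ℝ (Fin 2)}
    (h₀ : x ≤ w 0) (h₁ : x ≤ w 1) :
    w ∈ {y : EuclideanSpace ℝ (Fin 2) | min (y 0) (y 1) = x} + pos2 := by
  refine Set.mem_add.2 ⟨!₂[x, x], by simp, w - !₂[x, x], ?_, by simp⟩
  simp [pos2, h₀, h₁]

/-- If `a ≥ x + r` and `|z - a| ≤ 2 r`, moving `z` up to `x` costs at most half of `|z - a|`. -/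
theorem sq_sub_max_le {x r a z : ℝ} (hr : 0 ≤ r) (ha : x + r ≤ a) (hz : (z - a) ^ 2 ≤ (2 * r) ^ 2) :
    4 * (z - max z x) ^ 2 ≤ (z - a) ^ 2 := by
  have h := abs_le_of_sq_le_sq' hz (by positivity)
  rcases le_total x z with h' | h'
  · simpa [max_eq_left h'] using sq_nonneg (z - a)
  · rw [max_eq_right h']
    nlinarith

theorem cthickening_min_level_subset {x r : ℝ} (hr : 0 < r) :
    Metric.cthickening (2 * r)
        {y : EuclideanSpace ℝ (Fin 2) | min (y 0) (y 1) = x + r} ⊆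
      Metric.cthickening r
        ({y : EuclideanSpace ℝ (Fin 2) | min (y 0) (y 1) = x} + pos2) := by
  have hcl : IsClosed {y : EuclideanSpace ℝ (Fin 2) | min (y 0) (y 1) = x + r} :=
    isClosed_eq (by fun_prop) continuous_const
  rw [hcl.cthickening_eq_biUnion_closedBall (by positivity)]
  intro z hz
  obtain ⟨a, ha, hza⟩ := Set.mem_iUnion₂.1 hz
  have ha' : min (a 0) (a 1) = x + r := ha
  have ha₀ : x + r ≤ a 0 := ha' ▸ min_le_left _ _
  have ha₁ : x + r ≤ a 1 := ha' ▸ min_le_right _ _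
  rw [Metric.mem_closedBall, EuclideanSpace.dist_eq, Real.sqrt_le_left (by positivity)] at hza
  simp only [Fin.sum_univ_two, Real.dist_eq, sq_abs] at hza
  have h₀ := sq_sub_max_le hr.le ha₀
    (by linarith [sq_nonneg (z 1 - a 1)] : (z 0 - a 0) ^ 2 ≤ (2 * r) ^ 2)
  have h₁ := sq_sub_max_le hr.le ha₁
    (by linarith [sq_nonneg (z 0 - a 0)] : (z 1 - a 1) ^ 2 ≤ (2 * r) ^ 2)
  refine Metric.mem_cthickening_of_dist_le z !₂[max (z 0) x, max (z 1) x] r _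
    (mem_min_level_add_pos2 (by simp) (by simp)) ?_
  rw [EuclideanSpace.dist_eq, Real.sqrt_le_left hr.le]
  simp only [Fin.sum_univ_two, Real.dist_eq, sq_abs]
  simp only [Matrix.cons_val_zero, Matrix.cons_val_one]
  linarith

theorem add_mem_closedBall_self {x r : ℝ} (hr : 0 < r) : x + r ∈ Metric.closedBall x r := by
  simp [abs_of_pos hr]

theorem isIncBoundAt_min_level (x : ℝ) :
    IsIncBoundAt (fun z : ℝ => {y : EuclideanSpace ℝ (Fin 2) | min (y 0) (y 1) = z})
      pos2 x 2 :=
  ⟨one_lt_two, 1, one_pos, fun r hr _ =>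
    ⟨x + r, add_mem_closedBall_self hr, cthickening_min_level_subset hr⟩⟩

/-- The map `G(x) = {y ∈ ℝ² : min{y₁,y₂} = x}` is `ℝ²₊`-increasing at every point
with exact bound of increase at least `2`, the key inclusion being witnessed by
`u = x + r`. -/
theorem stmt6 :
    (∀ x r : ℝ, 0 < r →
      x + r ∈ Metric.closedBall x r ∧
      Metric.cthickening (2 * r)
          {y : EuclideanSpace ℝ (Fin 2) | min (y 0) (y 1) = x + r} ⊆
        Metric.cthickening r
          ({y : EuclideanSpace ℝ (Fin 2) | min (y 0) (y 1) = x} + pos2)) ∧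
    ∀ x : ℝ,
      CIncreasingAt (fun z : ℝ => {y : EuclideanSpace ℝ (Fin 2) | min (y 0) (y 1) = z})
        pos2 x ∧
      (2 : ℝ≥0∞) ≤
        incBound (fun z : ℝ => {y : EuclideanSpace ℝ (Fin 2) | min (y 0) (y 1) = z})
          pos2 x := by
  refine ⟨fun x r hr => ⟨add_mem_closedBall_self hr, cthickening_min_level_subset hr⟩,
    fun x => ⟨⟨2, isIncBoundAt_min_level x⟩, ?_⟩⟩
  have h := le_iSup₂ (f := fun (a : ℝ) (_ : a ∈ {a : ℝ | IsIncBoundAt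
    (fun z : ℝ => {y : EuclideanSpace ℝ (Fin 2) | min (y 0) (y 1) = z}) pos2 x a}) =>
      ENNReal.ofReal a) 2 (isIncBoundAt_min_level x)
  simpa [incBound] using h
end

section
/- Let (P,d_P) be a metric space, (X,d) a complete metric space, Y a normed vector space, F : P×X ⇉ Y with F(p,x) nonempty closed for every (p,x), and C ⊆ Y a fixed closed convex cone with {0} ≠ C ⊊ Y. Suppose that: (i) for every p ∈ P there exists x̂_p ∈ X with e(F(p,x̂_p), C) < +∞; (ii) F(p,·) is lower semicontinuous on X for every p; (iii) α_{F,C} > 1 (with C(p) ≡ C); (iv) (p̄,x̄) satisfies F(p̄,x̄) ⊆ C; (v) F(·,x̄) is Lipschitz u.s.c. at p̄, i.e. there exist ℓ̄, δ̄ > 0 with F(p,x̄) ⊆ B(F(p̄,x̄), ℓ̄·d_P(p,p̄)) for all p ∈ B(p̄,δ̄). Then the solution map S(p) = {x : F(p,x) ⊆ C} is Lipschitz lower semicontinuous at p̄: there exist ℓ, δ > 0 such that S(p) ∩ B(x̄, ℓ·d_P(p,p̄)) ≠ ∅ for every p ∈ B(p̄,δ). -/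
open Set Metric EMetric ENNReal Pointwise Filter Topology

/-- A lower semicontinuous `ℝ≥0∞`-valued function on a complete metric space which admits a
sufficient decrease at every point of its domain where it is positive vanishes within a controlled
distance of any point of its domain. -/
theorem exists_eq_zero_of_sufficient_decrease {X : Type*} [MetricSpace X] [CompleteSpace X]
    (φ : X → ℝ≥0∞) (hφ : LowerSemicontinuous φ) {k : ℝ} (hk : 0 < k)
    (hdec : ∀ x, φ x ≠ ⊤ → φ x ≠ 0 →
      ∃ u, φ u < φ x ∧ φ u + ENNReal.ofReal k * edist u x ≤ φ x)
    (x₀ : X) (hx₀ : φ x₀ ≠ ⊤) :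
    ∃ x, φ x = 0 ∧ ENNReal.ofReal k * edist x x₀ ≤ φ x₀ := by
  set K := ENNReal.ofReal k with hK
  have hK0 : K ≠ 0 := by simpa [hK] using hk
  let S : X → Set X := fun x => {u | φ u + K * edist u x ≤ φ x}
  have hself : ∀ x, x ∈ S x := fun x => by simp [S]
  have htrans : ∀ x u v, u ∈ S x → v ∈ S u → v ∈ S x := by
    intro x u v hu hv
    simp only [S, mem_ofPred_eq] at *
    calc φ v + K * edist v x ≤ φ v + K * (edist v u + edist u x) := by
          gcongr; exact edist_triangle _ _ _
      _ = (φ v + K * edist v u) + K * edist u x := by ring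
      _ ≤ φ u + K * edist u x := by gcongr
      _ ≤ φ x := hu
  have hle : ∀ x u, u ∈ S x → φ u ≤ φ x := fun x u hu => le_self_add.trans hu
  have hclosed : ∀ x, IsClosed (S x) := by
    intro x
    have hcont : Continuous fun u => K * edist u x :=
      (ENNReal.continuous_const_mul ENNReal.ofReal_ne_top).comp
        (continuous_id.edist continuous_const)
    exact (hφ.add hcont.lowerSemicontinuous).isClosed_preimage (φ x)
  have hnext : ∀ (n : ℕ) (x : X), φ x ≠ ⊤ →
      ∃ u ∈ S x, ∀ v ∈ S x, φ u ≤ φ v + (2⁻¹ : ℝ≥0∞) ^ n := by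
    intro n x hx
    have hfin : (⨅ v ∈ S x, φ v) ≠ ⊤ := ne_top_of_le_ne_top hx (iInf₂_le x (hself x))
    have hpow : (2⁻¹ : ℝ≥0∞) ^ n ≠ 0 := pow_ne_zero _ (by simp)
    have hlt := ENNReal.lt_add_right hfin hpow
    simp only [iInf_lt_iff, exists_prop] at hlt
    obtain ⟨u, hu, hlt⟩ := hlt
    exact ⟨u, hu, fun v hv => hlt.le.trans (by gcongr; exact iInf₂_le v hv)⟩
  choose! next hnextS hnextle using hnext
  let x : ℕ → X := fun n => Nat.rec x₀ (fun n y => next n y) n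
  have hxfin : ∀ n, φ (x n) ≠ ⊤ := by
    intro n
    induction n with
    | zero => exact hx₀
    | succ n ih => exact ne_top_of_le_ne_top ih (hle _ _ (hnextS n _ ih))
  have hxS : ∀ n m, n ≤ m → x m ∈ S (x n) := by
    intro n m hnm
    induction m, hnm using Nat.le_induction with
    | base => exact hself _
    | succ m _ ih => exact htrans _ _ _ ih (hnextS m _ (hxfin m))
  have hcauchy : CauchySeq x := by
    have hanti : Antitone fun n => (φ (x n)).toReal := fun n m hnm =>
      ENNReal.toReal_mono (hxfin n) (hle _ _ (hxS n m hnm))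
    have hbdd : BddBelow (range fun n => (φ (x n)).toReal) :=
      ⟨0, by rintro _ ⟨n, rfl⟩; exact ENNReal.toReal_nonneg⟩
    have hc := (tendsto_atTop_ciInf hanti hbdd).cauchySeq
    rw [Metric.cauchySeq_iff'] at hc ⊢
    intro ε hε
    obtain ⟨N, hN⟩ := hc (k * ε) (by positivity)
    refine ⟨N, fun n hn => ?_⟩
    have h1 := hN n hn
    have h2 := ENNReal.toReal_mono (hxfin N) (hxS N n hn)
    rw [ENNReal.toReal_add (hxfin n) (ENNReal.mul_ne_top ENNReal.ofReal_ne_top (edist_ne_top _ _)),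
      ENNReal.toReal_mul, ENNReal.toReal_ofReal hk.le, edist_dist,
      ENNReal.toReal_ofReal dist_nonneg] at h2
    rw [Real.dist_eq, abs_lt] at h1
    have h3 : k * dist (x n) (x N) < k * ε := by linarith [h1.1]
    exact lt_of_mul_lt_mul_left h3 hk.le
  obtain ⟨z, hz⟩ := cauchySeq_tendsto_of_complete hcauchy
  have hzS : ∀ n, z ∈ S (x n) := fun n =>
    (hclosed (x n)).mem_of_tendsto hz (eventually_atTop.2 ⟨n, fun m hm => hxS n m hm⟩)
  have hzfin : φ z ≠ ⊤ := ne_top_of_le_ne_top hx₀ (hle _ _ (hzS 0))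
  refine ⟨z, ?_, le_add_self.trans (hzS 0)⟩
  by_contra hz0
  obtain ⟨u, hlt, hu⟩ := hdec z hzfin hz0
  refine hlt.not_ge ?_
  have hbound : ∀ n : ℕ, φ z ≤ φ u + (2⁻¹ : ℝ≥0∞) ^ n := fun n =>
    (hle _ _ (hzS (n + 1))).trans
      (hnextle n (x n) (hxfin n) u (htrans _ _ _ (hzS n) hu))
  have hlim : Tendsto (fun n : ℕ => φ u + (2⁻¹ : ℝ≥0∞) ^ n) atTop (𝓝 (φ u + 0)) :=
    tendsto_const_nhds.add (ENNReal.tendsto_pow_atTop_nhds_zero_of_lt_one (by simp))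
  rw [add_zero] at hlim
  exact ge_of_tendsto' hlim hbound

theorem Convex.one_add_mul_infDist_le {Y : Type*} [SeminormedAddCommGroup Y] [NormedSpace ℝ Y]
    {C : Set Y} (hC : Convex ℝ C) {c : Y} (hc : c ∈ C) (y : Y) {t : ℝ} (ht : 0 ≤ t) :
    (1 + t) * infDist y C ≤ infDist (y + t • (y - c)) C := by
  refine (le_infDist ⟨c, hc⟩).2 fun c' hc' => ?_
  have h1 : (0 : ℝ) < 1 + t := by linarith
  have hw : (1 + t)⁻¹ • c' + (t * (1 + t)⁻¹) • c ∈ C :=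
    hC hc' hc (by positivity) (by positivity) (by field_simp)
  have heq : (1 + t) • (y - ((1 + t)⁻¹ • c' + (t * (1 + t)⁻¹) • c))
      = y + t • (y - c) - c' := by
    have h2 : (1 + t) * (t * (1 + t)⁻¹) = t := by field_simp
    rw [smul_sub, smul_add, smul_smul, smul_smul, mul_inv_cancel₀ h1.ne', h2]
    module
  calc (1 + t) * infDist y C
      ≤ (1 + t) * dist y ((1 + t)⁻¹ • c' + (t * (1 + t)⁻¹) • c) := by
        gcongr; exact infDist_le_dist_of_mem hw
    _ = dist (y + t • (y - c)) c' := by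
        rw [dist_eq_norm, dist_eq_norm, ← heq, norm_smul, Real.norm_of_nonneg h1.le]

/-- Outside a convex set, the distance to the set grows at unit rate in suitable directions. -/
theorem Convex.infDist_add_le_of_forall_closedBall {Y : Type*} [SeminormedAddCommGroup Y]
    [NormedSpace ℝ Y] {C : Set Y} (hC : Convex ℝ C) (hne : C.Nonempty) {y : Y} {r M : ℝ}
    (hr : 0 ≤ r) (hy : 0 < infDist y C) (h : ∀ z ∈ closedBall y r, infDist z C ≤ M) :
    infDist y C + r ≤ M := by
  have hM : infDist y C ≤ M := h y (mem_closedBall_self hr)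
  have key : ∀ c ∈ C, infDist y C * r ≤ (M - infDist y C) * dist y c := by
    intro c hc
    have hD : 0 < dist y c := hy.trans_le (infDist_le_dist_of_mem hc)
    have h1 := hC.one_add_mul_infDist_le hc y (t := r / dist y c) (by positivity)
    have h2 := h (y + (r / dist y c) • (y - c)) (by
      rw [Metric.mem_closedBall, dist_eq_norm, add_sub_cancel_left, norm_smul, ← dist_eq_norm,
        Real.norm_of_nonneg (by positivity), div_mul_cancel₀ _ hD.ne'])
    have h3 := mul_le_mul_of_nonneg_right (h1.trans h2) hD.le
    have h4 : (1 + r / dist y c) * infDist y C * dist y c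
        = infDist y C * dist y c + infDist y C * r := by field_simp
    linarith
  rcases hM.eq_or_lt with heq | hlt
  · obtain ⟨c, hc⟩ := hne
    have := key c hc
    rw [← heq, sub_self, zero_mul] at this
    nlinarith
  · have hpos : 0 < M - infDist y C := sub_pos.2 hlt
    have : infDist y C * r / (M - infDist y C) ≤ infDist y C :=
      (le_infDist hne).2 fun c hc => by
        rw [div_le_iff₀ hpos, mul_comm (dist y c)]; exact key c hc
    rw [div_le_iff₀ hpos] at this
    linarith [le_of_mul_le_mul_left this hy]

theorem excess_le {Y : Type*} [PseudoEMetricSpace Y] {A B : Set Y} {M : ℝ≥0∞}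
    (h : ∀ a ∈ A, infEDist a B ≤ M) : excess A B ≤ M :=
  iSup₂_le h

theorem infEDist_le_infEDist_add_excess {Y : Type*} [PseudoEMetricSpace Y] (z : Y) (A B : Set Y) :
    infEDist z B ≤ infEDist z A + excess A B := by
  rw [← tsub_le_iff_right]
  refine le_infEDist.2 fun a ha => ?_
  rw [tsub_le_iff_right]
  exact infEDist_le_edist_add_infEDist.trans (by gcongr; exact infEDist_le_excess ha)

theorem excess_eq_zero_iff {Y : Type*} [PseudoEMetricSpace Y] {A B : Set Y} (hB : IsClosed B) :
    excess A B = 0 ↔ A ⊆ B := by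
  constructor
  · intro h a ha
    rw [mem_iff_infEDist_zero_of_closed hB]
    exact le_antisymm ((infEDist_le_excess ha).trans h.le) bot_le
  · intro h
    exact le_antisymm (excess_le fun a ha => (infEDist_zero_of_mem (h ha)).le) bot_le

theorem LscSV.lowerSemicontinuous_excess {X Y : Type*} [TopologicalSpace X] [PseudoEMetricSpace Y]
    {G : X → Set Y} (hG : LscSV G) (C : Set Y) : LowerSemicontinuous fun x => excess (G x) C := by
  intro x M hM
  simp only [excess, lt_iSup_iff, exists_prop] at hM
  obtain ⟨y, hy, hMy⟩ := hM
  have hopen : IsOpen {y : Y | M < infEDist y C} := isOpen_lt continuous_const continuous_infEDist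
  filter_upwards [hG x _ hopen ⟨y, hy, hMy⟩] with x' ⟨y', hy', hMy'⟩
  exact lt_of_lt_of_le hMy' (infEDist_le_excess hy')

namespace IsClosedConvexCone

variable {Y : Type*} [SeminormedAddCommGroup Y] [NormedSpace ℝ Y] {C : Set Y}

theorem add_mem_s8 (hC : IsClosedConvexCone C) {a b : Y} (ha : a ∈ C) (hb : b ∈ C) : a + b ∈ C := by
  have h := hC.2.2.2 _ (hC.2.1 ha hb (show (0 : ℝ) ≤ 1 / 2 by norm_num)
    (show (0 : ℝ) ≤ 1 / 2 by norm_num) (by norm_num)) 2 (by norm_num)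
  rw [smul_add, smul_smul, smul_smul] at h
  simpa using h

theorem excess_add_le (hC : IsClosedConvexCone C) (A : Set Y) : excess (A + C) C ≤ excess A C := by
  refine excess_le ?_
  rintro _ ⟨a, ha, c, hc, rfl⟩
  refine le_trans (le_infEDist.2 fun c' hc' => ?_) (infEDist_le_excess ha)
  calc infEDist (a + c) C ≤ edist (a + c) (c' + c) := infEDist_le_edist_of_mem (hC.add_mem_s8 hc' hc)
    _ = edist a c' := edist_add_right _ _ _

end IsClosedConvexCone

theorem IsIncBoundAt.exists_excess_decrease {X Y : Type*} [PseudoMetricSpace X]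
    [SeminormedAddCommGroup Y] [NormedSpace ℝ Y] {G : X → Set Y} {C : Set Y} {x : X} {a : ℝ}
    (ha : IsIncBoundAt G C x a) (hC : IsClosedConvexCone C)
    (hfin : excess (G x) C ≠ ⊤) (h0 : excess (G x) C ≠ 0) :
    ∃ u, excess (G u) C < excess (G x) C ∧
      excess (G u) C + ENNReal.ofReal (a - 1) * edist u x ≤ excess (G x) C := by
  obtain ⟨ha1, δ, hδ, hinc⟩ := ha
  have hne : C.Nonempty := ⟨0, hC.2.2.1⟩
  set E := (excess (G x) C).toReal with hE
  have hEeq : excess (G x) C = ENNReal.ofReal E := (ENNReal.ofReal_toReal hfin).symm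
  have hEpos : 0 < E := ENNReal.toReal_pos h0 hfin
  have hk : 0 < a - 1 := by linarith
  set r := min δ (E / (a - 1)) with hr
  have hrpos : 0 < r := lt_min hδ (div_pos hEpos hk)
  have hkr : (a - 1) * r ≤ E := by
    have := min_le_right δ (E / (a - 1))
    rw [← hr, le_div_iff₀ hk] at this
    linarith
  obtain ⟨u, hu, hsub⟩ := hinc r hrpos (min_le_left _ _)
  have hle : excess (G u) C ≤ ENNReal.ofReal (E - (a - 1) * r) := by
    refine excess_le fun y hy => ?_
    rw [← ENNReal.ofReal_toReal (infEDist_ne_top hne)]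
    refine ENNReal.ofReal_le_ofReal ?_
    change infDist y C ≤ _
    rcases infDist_nonneg.eq_or_lt (a := (0 : ℝ)) (b := infDist y C) with h | h
    · linarith
    · have := hC.2.1.infDist_add_le_of_forall_closedBall hne (r := a * r) (M := r + E)
        (by positivity) h fun z hz => by
          have hz' := hsub (closedBall_subset_cthickening hy _ hz)
          rw [mem_cthickening_iff] at hz'
          have h1 : infEDist z C ≤ ENNReal.ofReal (r + E) := by
            rw [ENNReal.ofReal_add hrpos.le hEpos.le, ← hEeq]
            exact (infEDist_le_infEDist_add_excess z (G x + C) C).trans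
              (add_le_add hz' (hC.excess_add_le _))
          exact ENNReal.toReal_le_of_le_ofReal (by positivity) h1
      linarith
  refine ⟨u, hle.trans_lt ?_, ?_⟩
  · rw [hEeq]
    exact (ENNReal.ofReal_lt_ofReal_iff hEpos).2 (by nlinarith)
  · have hd : edist u x ≤ ENNReal.ofReal r := by
      rw [edist_dist]; exact ENNReal.ofReal_le_ofReal hu
    calc excess (G u) C + ENNReal.ofReal (a - 1) * edist u x
        ≤ ENNReal.ofReal (E - (a - 1) * r) + ENNReal.ofReal (a - 1) * ENNReal.ofReal r := by
          gcongr
      _ = excess (G x) C := by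
          rw [hEeq, ← ENNReal.ofReal_mul hk.le, ← ENNReal.ofReal_add (by linarith) (by positivity)]
          congr 1; ring

/-- Lipschitz lower semicontinuity of the solution map at a reference pair, under
Lipschitz upper semicontinuity of `F(·,xbar)` at `pbar`. -/
theorem stmt8 {P X Y : Type*} [MetricSpace P] [MetricSpace X] [CompleteSpace X]
    [NormedAddCommGroup Y] [NormedSpace ℝ Y]
    (F : P → X → Set Y) (C : Set Y)
    (hF : ∀ p x, (F p x).Nonempty ∧ IsClosed (F p x))
    (hC : IsClosedConvexCone C) (hCne : ({0} : Set Y) ≠ C) (hCpr : C ≠ Set.univ)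
    (hi : ∀ p : P, ∃ xhat : X, excess (F p xhat) C ≠ ⊤)
    (hii : ∀ p : P, LscSV (F p))
    (hiii : 1 < alphaFC F (fun _ => C))
    (pbar : P) (xbar : X) (hiv : F pbar xbar ⊆ C)
    (hv : ∃ ℓ' > (0:ℝ), ∃ δ' > (0:ℝ), ∀ p ∈ Metric.closedBall pbar δ',
      F p xbar ⊆ Metric.cthickening (ℓ' * dist p pbar) (F pbar xbar)) :
    ∃ ℓ > (0:ℝ), ∃ δ > (0:ℝ), ∀ p ∈ Metric.closedBall pbar δ,
      ({x : X | F p x ⊆ C} ∩ Metric.closedBall xbar (ℓ * dist p pbar)).Nonempty := by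
  have hne : C.Nonempty := ⟨0, hC.2.2.1⟩
  obtain ⟨ℓ', hℓ', δ', hδ', hv⟩ := hv
  obtain ⟨b, hb1, hb⟩ := exists_between hiii
  have hbtop : b ≠ ⊤ := ne_top_of_lt hb
  have hk : 0 < b.toReal - 1 := by
    have := (ENNReal.toReal_lt_toReal ENNReal.one_ne_top hbtop).2 hb1
    simpa using this
  refine ⟨ℓ' / (b.toReal - 1), div_pos hℓ' hk, δ', hδ', fun p hp => ?_⟩
  have hstart : excess (F p xbar) C ≤ ENNReal.ofReal (ℓ' * dist p pbar) :=
    excess_le fun y hy => (infEDist_anti hiv).trans (mem_cthickening_iff.1 (hv p hp hy))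
  obtain ⟨x, hx0, hx⟩ := exists_eq_zero_of_sufficient_decrease (fun x => excess (F p x) C)
    ((hii p).lowerSemicontinuous_excess C) hk (fun x hfin h0 => by
      have hnot : ¬ F p x ⊆ C := fun h => h0 ((excess_eq_zero_iff hC.1).2 h)
      have hlt : b < incBound (F p) C x := hb.trans_le (iInf₂_le (p, x) hnot)
      simp only [incBound, lt_iSup_iff, exists_prop] at hlt
      obtain ⟨a, ha, hba⟩ := hlt
      obtain ⟨u, hu1, hu2⟩ := IsIncBoundAt.exists_excess_decrease ha hC hfin h0
      have hab : b.toReal ≤ a := ENNReal.toReal_le_of_le_ofReal (by linarith [ha.1]) hba.le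
      exact ⟨u, hu1, le_trans (by gcongr) hu2⟩)
    xbar (ne_top_of_le_ne_top ENNReal.ofReal_ne_top hstart)
  refine ⟨x, (excess_eq_zero_iff hC.1).1 hx0, ?_⟩
  have h := hx.trans hstart
  rw [edist_dist, ← ENNReal.ofReal_mul hk.le,
    ENNReal.ofReal_le_ofReal_iff (by positivity)] at h
  rw [Metric.mem_closedBall, div_mul_eq_mul_div, le_div_iff₀ hk]
  linarith
end

section
/- Let (X,d) be a metrically convex, complete metric space, let S ⊆ X be a proximinal set, and let x ∈ X \ S. Then for every r ∈ (0, dist(x,S)) there exists u ∈ B(x,r) \ {x} such that dist(u,S) = dist(x,S) − d(u,x). -/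
open Set Metric EMetric ENNReal Pointwise Filter Topology

/-- In a complete metric space, a nonempty family of points that is linearly ordered by
betweenness relative to `a` converges towards `a` to a point lying between `a` and each of them. -/
theorem exists_between_of_isChain {X : Type*} [MetricSpace X] [CompleteSpace X] (a : X)
    {c : Set X} (hc : IsChain (fun u v => dist a v + dist v u = dist a u) c) (hne : c.Nonempty) :
    ∃ w ∈ closure c, ∀ v ∈ c, dist a w + dist w v = dist a v := by
  have hiso : ∀ u ∈ c, ∀ v ∈ c, dist u v = |dist a u - dist a v| := by
    intro u hu v hv
    have hnn : 0 ≤ dist u v := dist_nonneg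
    rcases eq_or_ne u v with rfl | huv
    · simp
    rcases hc hu hv huv with h | h
    · rw [dist_comm v u] at h
      rw [abs_of_nonneg (by linarith)]
      linarith
    · rw [abs_of_nonpos (by linarith)]
      linarith
  have hbdd : BddBelow (dist a '' c) := ⟨0, by rintro _ ⟨u, -, rfl⟩; exact dist_nonneg⟩
  obtain ⟨t, -, ht, htc⟩ := exists_seq_tendsto_sInf (hne.image (dist a)) hbdd
  choose u huc hut using htc
  have hcau : CauchySeq u := by
    have := ht.cauchySeq
    rw [Metric.cauchySeq_iff] at this ⊢
    intro ε hε
    obtain ⟨N, hN⟩ := this ε hε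
    refine ⟨N, fun m hm n hn => ?_⟩
    rw [hiso _ (huc m) _ (huc n), hut, hut, ← Real.dist_eq]
    exact hN m hm n hn
  obtain ⟨w, hw⟩ := cauchySeq_tendsto_of_complete hcau
  have haw : dist a w = sInf (dist a '' c) :=
    tendsto_nhds_unique (tendsto_const_nhds.dist hw) (by simpa only [hut] using ht)
  refine ⟨w, mem_closure_of_tendsto hw (Eventually.of_forall huc), fun v hv => ?_⟩
  have hle : dist a w ≤ dist a v := haw ▸ csInf_le hbdd ⟨v, hv, rfl⟩
  have hwv : dist w v = |dist a w - dist a v| := by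
    refine tendsto_nhds_unique (hw.dist tendsto_const_nhds) ?_
    simp only [hiso _ (huc _) _ hv]
    exact ((tendsto_const_nhds.dist hw).sub_const _).abs
  rw [hwv, abs_of_nonpos (by linarith)]
  ring

/-- In a metrically convex complete metric space, there are points between `a` and `b`
that are distinct from `a` and arbitrarily close to it. -/
theorem MetricallyConvex.exists_between_dist_le {X : Type*} [MetricSpace X] [CompleteSpace X]
    (hX : MetricallyConvex X) {a b : X} (hab : a ≠ b) {r : ℝ} (hr : 0 < r) :
    ∃ u, u ≠ a ∧ dist a u ≤ r ∧ dist a u + dist u b = dist a b := by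
  rcases le_total (dist a b) r with h | h
  · exact ⟨b, hab.symm, h, by simp⟩
  have htrans : ∀ {u v w : X}, dist a v + dist v u = dist a u →
      dist a w + dist w v = dist a v → dist a w + dist w u = dist a u := by
    intro u v w huv hvw
    linarith [dist_triangle a w u, dist_triangle w v u]
  let T : Set X := {u | r ≤ dist a u ∧ dist a u + dist u b = dist a b}
  have hT : IsClosed T :=
    (isClosed_le (f := fun _ => r) (g := fun u => dist a u) (by fun_prop) (by fun_prop)).inter
      (isClosed_eq (f := fun u => dist a u + dist u b) (g := fun _ => dist a b)
        (by fun_prop) (by fun_prop))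
  have : Nonempty T := ⟨⟨b, h, by simp⟩⟩
  obtain ⟨⟨m, hmr, hmb⟩, hm⟩ := exists_maximal_of_nonempty_chains_bounded
    (r := fun u v : T => dist a (v : X) + dist (v : X) u = dist a (u : X))
    (by
      intro c hc hne
      have hc' : IsChain (fun u v => dist a v + dist v u = dist a u) (Subtype.val '' c) := by
        rintro _ ⟨u, hu, rfl⟩ _ ⟨v, hv, rfl⟩ huv
        exact hc hu hv fun h => huv (congrArg _ h)
      obtain ⟨w, hwc, hw⟩ := exists_between_of_isChain a hc' (hne.image _)
      have hwT : w ∈ T := closure_minimal (by rintro _ ⟨u, -, rfl⟩; exact u.2) hT hwc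
      exact ⟨⟨w, hwT⟩, fun v hv => hw v ⟨v, hv, rfl⟩⟩)
    (fun huv hvw => htrans huv hvw)
  have ham : a ≠ m := by
    rintro rfl
    rw [dist_self] at hmr
    linarith
  obtain ⟨c, hca, hcm, hc⟩ := hX a m ham
  have hcb : dist a c + dist c b = dist a b := htrans (by simpa [dist_comm] using hmb) hc.symm
  refine ⟨c, hca, ?_, hcb⟩
  by_contra! hrc
  have hmc := hm ⟨c, hrc.le, hcb⟩ hc.symm
  simp only [dist_comm m c] at hmc
  exact hcm (dist_le_zero.mp (by linarith))

/-- In a metrically convex complete metric space, the distance to a proximinal set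
decreases exactly linearly along a geodesic direction. -/
theorem stmt12 {X : Type*} [MetricSpace X] [CompleteSpace X]
    (hX : MetricallyConvex X)
    (S : Set X) (hS : Proximinal S) (x : X) (hx : x ∉ S) :
    ∀ r : ℝ, 0 < r → r < Metric.infDist x S →
      ∃ u ∈ Metric.closedBall x r, u ≠ x ∧
        Metric.infDist u S = Metric.infDist x S - dist u x := by
  intro r hr hrS
  obtain ⟨s, hsS, hs⟩ := hS x
  have hxs : x ≠ s := dist_pos.mp (by linarith)
  obtain ⟨u, hux, hur, hu⟩ := hX.exists_between_dist_le hxs hr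
  rw [dist_comm x u] at hur hu
  refine ⟨u, hur, hux, le_antisymm ?_ ?_⟩
  · linarith [infDist_le_dist_of_mem (x := u) hsS]
  · linarith [infDist_le_infDist_add_dist (s := S) (x := x) (y := u), dist_comm x u]
end

section
/- (Global continuous dependence of ideal efficient solutions) Let P be a paracompact topological space, f : P×ℝⁿ → ℝᵐ, R : P ⇉ ℝⁿ with nonempty closed values, and C ⊆ ℝᵐ a fixed pointed closed convex cone with {0} ≠ C ⊊ ℝᵐ. Suppose that: (ii) for every p ∈ P, the set f(p,R(p)) is closed and C-bounded (i.e. f(p,R(p)) \ C is bounded); (iii) α̲_{f,C,R} > 1; (iv) f(p,·) is continuous on ℝⁿ for every p and Lipschitz continuous on ℝⁿ \ R(p) with constant ℓ_f, 0 < ℓ_f < α̲_{f,C,R} − 1, uniform in p; (v) f(p,·) is C-convex on ℝⁿ for every p; (vi) f(·,x) is continuous on P uniformly in x ∈ ℝⁿ (for every p₀ and ε > 0 there is a neighbourhood V of p₀ with ‖f(p,x) − f(p₀,x)‖ ≤ ε for all p ∈ V and all x ∈ ℝⁿ); (vii) R : P ⇉ ℝⁿ is continuous (both lower and upper semicontinuous)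 on P and takes convex values. Then the ideal efficient solution set IE(p) = {x ∈ R(p) : f(p,R(p)) − f(p,x) ⊆ C} is nonempty for every p ∈ P and there exists a function ι : P → ℝⁿ, continuous on P, with ι(p) ∈ IE(p) for every p ∈ P. -/
open Set Metric EMetric ENNReal Pointwise Filter Topology

/-- The constant `α̲_{f,C,R}` of a parameterized vector optimization problem. -/
noncomputable def alphaUnder {P : Type*} {n m : ℕ}
    (f : P → EuclideanSpace ℝ (Fin n) → EuclideanSpace ℝ (Fin m))
    (Cm : P → Set (EuclideanSpace ℝ (Fin m)))
    (R : P → Set (EuclideanSpace ℝ (Fin n))) : ℝ≥0∞ :=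
  ⨅ q ∈ {q : P × EuclideanSpace ℝ (Fin n) |
      q.2 ∈ R q.1 ∧ ¬ (f q.1 '' R q.1 - {f q.1 q.2} ⊆ Cm q.1)},
    decBound (f q.1) (Cm q.1) q.2

section Auxiliary

lemma image_sub_singleton_subset_iff {E F : Type*} [AddGroup F] {g : E → F} {S : Set E}
    {C : Set F} {x : E} : g '' S - {g x} ⊆ C ↔ ∀ z ∈ S, g z - g x ∈ C := by
  rw [Set.sub_singleton, Set.image_image, Set.image_subset_iff]
  rfl

lemma IsClosedConvexCone.add_mem_s17 {F : Type*} [SeminormedAddCommGroup F] [NormedSpace ℝ F]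
    {C : Set F} (hC : IsClosedConvexCone C) {a b : F} (ha : a ∈ C) (hb : b ∈ C) :
    a + b ∈ C := by
  have h := hC.2.2.2 _ (hC.2.1 ha hb (by norm_num : (0:ℝ) ≤ 1/2) (by norm_num : (0:ℝ) ≤ 1/2)
    (by norm_num)) 2 (by norm_num)
  rw [← smul_add, smul_smul] at h
  norm_num at h
  exact h

/-- Cancellation of a ball of radius `r` for closed convex sets. -/
lemma closedBall_subset_of_subset_cthickening {F : Type*} [NormedAddCommGroup F]
    [InnerProductSpace ℝ F] [CompleteSpace F] {D : Set F} (hne : D.Nonempty) (hcl : IsClosed D)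
    (hconv : Convex ℝ D) {y : F} {r ρ : ℝ} (hr : 0 ≤ r)
    (h : Metric.closedBall y (ρ + r) ⊆ cthickening r D) : Metric.closedBall y ρ ⊆ D := by
  intro v hv
  by_contra hvD
  obtain ⟨q, hq, hqmin⟩ := exists_norm_eq_iInf_of_complete_convex hne hcl.isComplete hconv v
  have hin := (norm_eq_iInf_iff_real_inner_le_zero hconv hq).1 hqmin
  have hpos : 0 < ‖v - q‖ := norm_pos_iff.2 (sub_ne_zero.2 fun h => hvD (h ▸ hq))
  set e : F := ‖v - q‖⁻¹ • (v - q) with he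
  have hnorm : ‖e‖ = 1 := by
    rw [he, norm_smul, norm_inv, norm_norm, inv_mul_cancel₀ hpos.ne']
  have hmem : v + r • e ∈ Metric.closedBall y (ρ + r) := by
    rw [Metric.mem_closedBall, dist_eq_norm] at hv ⊢
    calc ‖v + r • e - y‖ = ‖(v - y) + r • e‖ := by congr 1; abel
      _ ≤ ‖v - y‖ + ‖r • e‖ := norm_add_le _ _
      _ ≤ ρ + r := by
        rw [norm_smul, hnorm, mul_one, Real.norm_of_nonneg hr]
        linarith
  have hle : infDist (v + r • e) D ≤ r := ENNReal.toReal_le_of_le_ofReal hr (h hmem)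
  have hge : ‖v - q‖ + r ≤ infDist (v + r • e) D := by
    refine (le_infDist hne).2 fun w hw => ?_
    have h1 : inner ℝ e (v + r • e - w) ≤ dist (v + r • e) w := by
      rw [dist_eq_norm]
      simpa [hnorm] using real_inner_le_norm e (v + r • e - w)
    have h2 : inner ℝ e (v + r • e - w) = ‖v - q‖ + r - ‖v - q‖⁻¹ * inner ℝ (v - q) (w - q) := by
      have : v + r • e - w = (v - q) + r • e - (w - q) := by abel
      rw [this, inner_sub_right, inner_add_right, inner_smul_right, real_inner_self_eq_norm_sq,
        hnorm, he, real_inner_smul_left, real_inner_smul_left, real_inner_self_eq_norm_sq]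
      field_simp
    have h3 : ‖v - q‖⁻¹ * inner ℝ (v - q) (w - q) ≤ 0 :=
      mul_nonpos_of_nonneg_of_nonpos (inv_nonneg.2 hpos.le) (hin w hw)
    linarith
  linarith

lemma infDist_add_le_of_closedBall_subset {F : Type*} [NormedAddCommGroup F] [NormedSpace ℝ F]
    [ProperSpace F] {C : Set F} (hC : IsClosedConvexCone C) {y c : F} {t ρ : ℝ} (ht : 0 < t)
    (hρ : 0 ≤ ρ) (hρt : ρ ≤ t) (hy : infDist y C ≤ t) (hc : Metric.closedBall c ρ ⊆ C) :
    infDist (y + c) C ≤ t - ρ := by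
  obtain ⟨q, hq, hqd⟩ := hC.1.exists_infDist_eq_dist ⟨0, hC.2.2.1⟩ y
  have hyq : ‖y - q‖ ≤ t := by rw [← dist_eq_norm, ← hqd]; exact hy
  have h1 : c + (ρ / t) • (y - q) ∈ C := by
    apply hc
    rw [Metric.mem_closedBall, dist_eq_norm, add_sub_cancel_left, norm_smul,
      Real.norm_of_nonneg (by positivity)]
    calc ρ / t * ‖y - q‖ ≤ ρ / t * t := by gcongr
      _ = ρ := by field_simp
  refine (infDist_le_dist_of_mem (hC.add_mem_s17 hq h1)).trans ?_
  have h2 : y + c - (q + (c + (ρ / t) • (y - q))) = (1 - ρ / t) • (y - q) := by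
    rw [sub_smul, one_smul]; abel
  have h3 : 0 ≤ 1 - ρ / t := by rw [sub_nonneg, div_le_one ht]; exact hρt
  rw [dist_eq_norm, h2, norm_smul, Real.norm_of_nonneg h3]
  calc (1 - ρ / t) * ‖y - q‖ ≤ (1 - ρ / t) * t := by gcongr
    _ = t - ρ := by field_simp

/-- Existence of an ideal efficient point, with an error bound, from a constrained decrease
condition. -/
lemma exists_ideal_of_decrease {E F : Type*} [MetricSpace E] [ProperSpace E]
    [NormedAddCommGroup F] [NormedSpace ℝ F] [ProperSpace F] {C : Set F}
    (hC : IsClosedConvexCone C) {S : Set E} (hS : IsClosed S) {g : E → F} (hg : Continuous g)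
    {s σ : ℝ} (hσ : 0 < σ) (hσs : σ < s)
    (hdec : ∀ x ∈ S, (¬ ∀ z ∈ S, g z - g x ∈ C) → ∃ δ : ℝ, 0 < δ ∧ ∀ r : ℝ, 0 < r → r ≤ δ →
      ∃ w ∈ S, dist w x ≤ r ∧ Metric.closedBall (g x - g w) (s * r) ⊆ C)
    {x₀ : E} (hx₀ : x₀ ∈ S) {t₀ : ℝ} (ht₀ : 0 ≤ t₀)
    (hbd : ∀ z ∈ S, infDist (g z - g x₀) C ≤ t₀) :
    ∃ x ∈ S, (∀ z ∈ S, g z - g x ∈ C) ∧ σ * dist x x₀ ≤ t₀ := by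
  have hCne : C.Nonempty := ⟨0, hC.2.2.1⟩
  let T : Set (E × ℝ) := {q | q.1 ∈ S ∧ ∀ z ∈ S, infDist (g z - g q.1) C ≤ q.2}
  let K : Set (E × ℝ) := Metric.closedBall x₀ (t₀ / σ) ×ˢ Icc 0 t₀
  have hT : IsClosed T := by
    have : T = Prod.fst ⁻¹' S ∩ ⋂ z ∈ S, {q : E × ℝ | infDist (g z - g q.1) C ≤ q.2} := by
      ext q; simp [T]
    rw [this]
    refine (hS.preimage continuous_fst).inter (isClosed_biInter fun z _ => ?_)
    refine isClosed_le ((continuous_infDist_pt C).comp ?_) continuous_snd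
    exact continuous_const.sub (hg.comp continuous_fst)
  have hK : IsCompact (K ∩ T) := ((isCompact_closedBall _ _).prod isCompact_Icc).inter_right hT
  have h0 : (x₀, t₀) ∈ K ∩ T := by
    refine ⟨⟨Metric.mem_closedBall_self (by positivity), ht₀, le_rfl⟩, hx₀, hbd⟩
  obtain ⟨⟨x, t⟩, ⟨⟨hxK, htK⟩, hxS, hxt⟩, hmin⟩ := hK.exists_isMinOn ⟨_, h0⟩
    (f := fun q : E × ℝ => q.2 + σ * dist q.1 x₀) (by fun_prop)
  have hle : t + σ * dist x x₀ ≤ t₀ := by simpa using hmin h0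
  refine ⟨x, hxS, ?_, by linarith [htK.1]⟩
  by_contra hx
  have htpos : 0 < t := by
    rcases htK.1.lt_or_eq with h | h
    · exact h
    · refine absurd (fun z hz => ?_) hx
      refine (hC.1.mem_iff_infDist_zero hCne).2 (le_antisymm ?_ infDist_nonneg)
      exact (hxt z hz).trans h.symm.le
  have hs : 0 < s := hσ.trans hσs
  obtain ⟨δ, hδ, hd⟩ := hdec x hxS hx
  set r := min δ (t / s) with hr
  have hrpos : 0 < r := lt_min hδ (by positivity)
  have hsr : s * r ≤ t := by
    have : r ≤ t / s := min_le_right _ _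
    rw [le_div_iff₀ hs] at this
    linarith
  obtain ⟨w, hwS, hwx, hwC⟩ := hd r hrpos (min_le_left _ _)
  have hwT : (w, t - s * r) ∈ T := by
    refine ⟨hwS, fun z hz => ?_⟩
    have := infDist_add_le_of_closedBall_subset hC htpos (by positivity) hsr (hxt z hz) hwC
    simpa using this
  have hlt : t - s * r + σ * dist w x₀ < t + σ * dist x x₀ := by
    have h1 : dist w x₀ ≤ r + dist x x₀ := (dist_triangle w x x₀).trans (by linarith)
    have h2 : σ * dist w x₀ ≤ σ * (r + dist x x₀) := by gcongr
    have h3 : σ * r < s * r := by gcongr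
    linarith
  have hwK : (w, t - s * r) ∈ K := by
    refine ⟨?_, sub_nonneg.2 hsr, ?_⟩
    · rw [Metric.mem_closedBall, le_div_iff₀ hσ]
      linarith
    · have : 0 ≤ s * r := by positivity
      exact (by linarith [htK.2] : t - s * r ≤ t₀)
  exact absurd (hmin ⟨hwK, hwT⟩) (not_le.2 hlt)

/-- Metric decrease, together with the Lipschitz condition off `S`, yields decrease within `S`. -/
lemma exists_mem_decrease {E F : Type*} [NormedAddCommGroup E] [NormedSpace ℝ E]
    [NormedAddCommGroup F] [InnerProductSpace ℝ F] [CompleteSpace F] {C : Set F}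
    (hC : IsClosedConvexCone C) {S : Set E} (hS : IsClosed S) {g : E → F} (hg : Continuous g)
    {l : ℝ} (hl : 0 ≤ l) (hlip : ∀ x₁ ∉ S, ∀ x₂ ∉ S, dist (g x₁) (g x₂) ≤ l * dist x₁ x₂)
    {a b : ℝ} (hab : a ≤ b) {x : E} (hx : x ∈ S)
    (hinc : IsIncBoundAt (fun x => ({-g x} : Set F)) C x b) :
    ∃ δ : ℝ, 0 < δ ∧ ∀ r : ℝ, 0 < r → r ≤ δ →
      ∃ w ∈ S, dist w x ≤ r ∧ Metric.closedBall (g x - g w) ((a - 1 - l) * r) ⊆ C := by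
  obtain ⟨-, δ, hδ, h⟩ := hinc
  refine ⟨δ, hδ, fun r hr hrδ => ?_⟩
  obtain ⟨u, hu, hsub⟩ := h r hr hrδ
  have hux : dist u x ≤ r := hu
  have hbase : Metric.closedBall (g x - g u) ((b - 1) * r) ⊆ C := by
    have hD : Metric.closedBall (-g u) ((b - 1) * r) ⊆ {-g x} + C := by
      refine closedBall_subset_of_subset_cthickening
        ((singleton_nonempty _).add ⟨0, hC.2.2.1⟩) ?_ ((convex_singleton _).add hC.2.1) hr.le
        (Subset.trans ?_ hsub)
      · rw [singleton_add]
        exact (Homeomorph.addLeft (-g x)).isClosedMap _ hC.1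
      · rw [show (b - 1) * r + r = b * r by ring]
        exact closedBall_subset_cthickening (mem_singleton _) _
    intro v hv
    have : v - g x ∈ {-g x} + C := by
      apply hD
      rw [Metric.mem_closedBall, dist_eq_norm] at hv ⊢
      convert hv using 2
      abel
    rw [singleton_add] at this
    obtain ⟨c, hc, hcv⟩ := this
    have hcv' : -g x + c = v - g x := hcv
    obtain rfl : c = v := by
      rwa [neg_add_eq_sub, sub_left_inj] at hcv'
    exact hc
  have key : ∃ w ∈ S, dist w x ≤ r ∧ dist (g w) (g u) ≤ l * r := by
    by_cases huS : u ∈ S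
    · exact ⟨u, huS, hux, by rw [dist_self]; positivity⟩
    · obtain ⟨w, hw, hwS, hwc⟩ := isPreconnected_closed_iff.1
        (convex_segment (𝕜 := ℝ) x u).isPreconnected S (closure Sᶜ) hS isClosed_closure
        (fun y _ => (em (y ∈ S)).imp_right fun hy => subset_closure hy)
        ⟨x, left_mem_segment ℝ x u, hx⟩ ⟨u, right_mem_segment ℝ x u, subset_closure huS⟩
      have hwx : dist w x ≤ r := (convex_closedBall x r).segment_subset
        (Metric.mem_closedBall_self hr.le) hu hw
      have hwu : dist w u ≤ r := (convex_closedBall u r).segment_subset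
        (Metric.mem_closedBall'.2 hux) (Metric.mem_closedBall_self hr.le) hw
      have hcl : IsClosed {w | dist (g w) (g u) ≤ l * dist w u} :=
        isClosed_le (by fun_prop) (by fun_prop)
      have : dist (g w) (g u) ≤ l * dist w u :=
        closure_minimal (fun y hy => hlip y hy u huS) hcl hwc
      exact ⟨w, hwS, hwx, this.trans (by gcongr)⟩
  obtain ⟨w, hwS, hwx, hwu⟩ := key
  refine ⟨w, hwS, hwx, (Metric.closedBall_subset_closedBall' ?_).trans hbase⟩
  rw [dist_sub_left, dist_comm, dist_comm]
  have : a * r ≤ b * r := by gcongr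
  linarith

/-- A lower semicontinuous convex-valued map with closed graph into a proper inner product space
has a continuous selection, namely its element of least norm. -/
lemma exists_continuous_selection_of_isClosed_graph {P E : Type*} [TopologicalSpace P]
    [NormedAddCommGroup E] [InnerProductSpace ℝ E] [ProperSpace E] {I : P → Set E}
    (hne : ∀ p, (I p).Nonempty) (hconv : ∀ p, Convex ℝ (I p))
    (hgraph : IsClosed {q : P × E | q.2 ∈ I q.1})
    (hlsc : ∀ p, ∀ x ∈ I p, ∀ ε : ℝ, 0 < ε → ∀ᶠ p' in 𝓝 p, ∃ y ∈ I p', dist y x ≤ ε) :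
    ∃ ι : P → E, Continuous ι ∧ ∀ p, ι p ∈ I p := by
  have hcl : ∀ p, IsClosed (I p) := fun p =>
    hgraph.preimage (f := fun x : E => (p, x)) (by fun_prop)
  have hproj : ∀ p, ∃ x ∈ I p, ∀ w ∈ I p, 0 ≤ inner ℝ x (w - x) := by
    intro p
    obtain ⟨x, hx, hmin⟩ :=
      exists_norm_eq_iInf_of_complete_convex (hne p) (hcl p).isComplete (hconv p) 0
    refine ⟨x, hx, fun w hw => ?_⟩
    have := (norm_eq_iInf_iff_real_inner_le_zero (hconv p) hx).1 hmin w hw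
    rw [zero_sub, inner_neg_left] at this
    linarith
  choose ι hι hvar using hproj
  have hsq : ∀ p, ∀ w ∈ I p, ‖w - ι p‖ ^ 2 ≤ ‖w‖ ^ 2 - ‖ι p‖ ^ 2 := by
    intro p w hw
    have h1 : ‖w‖ ^ 2 = ‖ι p‖ ^ 2 + 2 * inner ℝ (ι p) (w - ι p) + ‖w - ι p‖ ^ 2 := by
      rw [← norm_add_sq_real, add_sub_cancel]
    linarith [hvar p w hw]
  have hle : ∀ p, ∀ w ∈ I p, ‖ι p‖ ≤ ‖w‖ := by
    intro p w hw
    refine le_of_sq_le_sq ?_ (norm_nonneg _)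
    linarith [hsq p w hw, sq_nonneg ‖w - ι p‖]
  have hev : ∀ p, ∀ ε : ℝ, 0 < ε → ∀ᶠ p' in 𝓝 p, ‖ι p'‖ ≤ ‖ι p‖ + ε := by
    intro p ε hε
    filter_upwards [hlsc p (ι p) (hι p) ε hε] with p' ⟨y, hy, hyd⟩
    refine (hle p' y hy).trans ?_
    rw [dist_eq_norm] at hyd
    linarith [norm_sub_norm_le y (ι p)]
  refine ⟨ι, continuous_iff_continuousAt.2 fun p => ?_, hι⟩
  refine (isCompact_closedBall (0 : E) (‖ι p‖ + 1)).tendsto_nhds_of_unique_mapClusterPt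
    ?_ fun y _ hy => ?_
  · filter_upwards [hev p 1 one_pos] with p' hp'
    simpa using hp'
  · have hyI : y ∈ I p := by
      have : (p, y) ∈ closure {q : P × E | q.2 ∈ I q.1} := by
        rw [mem_closure_iff_nhds_basis ((𝓝 p).basis_sets.prod_nhds (𝓝 y).basis_sets)]
        rintro ⟨U, V⟩ ⟨hU, hV⟩
        obtain ⟨p', hp'V, hp'U⟩ := ((mapClusterPt_iff_frequently.1 hy V hV).and_eventually hU).exists
        exact ⟨(p', ι p'), hι p', hp'U, hp'V⟩
      rwa [hgraph.closure_eq] at this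
    have hyn : ‖y‖ ≤ ‖ι p‖ := by
      refine le_of_forall_pos_le_add fun ε hε => ?_
      have hcl' : IsClosed {z : E | ‖z‖ ≤ ‖ι p‖ + ε} := isClosed_le (by fun_prop) (by fun_prop)
      refine hcl'.closure_subset (mem_closure_iff_nhds.2 fun V hV => ?_)
      obtain ⟨p', hp'V, hp'⟩ :=
        ((mapClusterPt_iff_frequently.1 hy V hV).and_eventually (hev p ε hε)).exists
      exact ⟨ι p', hp'V, hp'⟩
    have h2 : ‖y‖ ^ 2 ≤ ‖ι p‖ ^ 2 := by gcongr
    have h3 : ‖y - ι p‖ ^ 2 ≤ 0 := by linarith [hsq p y hyI]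
    exact sub_eq_zero.1 (norm_eq_zero.1 (pow_eq_zero_iff two_ne_zero |>.1
      (le_antisymm h3 (sq_nonneg _))))

/-- The ideal efficient solution map has closed graph. -/
lemma isClosed_graph_ideal {P E F : Type*} [TopologicalSpace P] [TopologicalSpace E]
    [RegularSpace E] [NormedAddCommGroup F] {f : P → E → F} {R : P → Set E} {C : Set F}
    (hC : IsClosed C) (hR : ∀ p, IsClosed (R p)) (hf : ∀ p, Continuous (f p))
    (hunif : ∀ p₀ : P, ∀ ε : ℝ, 0 < ε → ∀ᶠ p in 𝓝 p₀, ∀ x, ‖f p x - f p₀ x‖ ≤ ε)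
    (hlsc : LscSV R) (husc : UscSV R) :
    IsClosed {q : P × E | q.2 ∈ R q.1 ∧ ∀ z ∈ R q.1, f q.1 z - f q.1 q.2 ∈ C} := by
  refine isClosed_of_closure_subset ?_
  rintro ⟨p, x⟩ hpx
  rw [mem_closure_iff_nhds_basis ((𝓝 p).basis_sets.prod_nhds (𝓝 x).basis_sets)] at hpx
  constructor
  · by_contra hx
    have hdis : Disjoint (𝓝ˢ (R p)) (𝓝 x) :=
      disjoint_nhdsSet_nhds.2 ((hR p).closure_eq.symm ▸ hx)
    obtain ⟨U, ⟨hU, hRU⟩, V, hV, hdis⟩ :=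
      ((hasBasis_nhdsSet (R p)).disjoint_iff (𝓝 x).basis_sets).1 hdis
    obtain ⟨⟨p', x'⟩, ⟨hx', -⟩, hp', hxV'⟩ := hpx (_, V) ⟨husc p U hU hRU, hV⟩
    exact hdis.le_bot ⟨hp' hx', hxV'⟩
  · intro z hz
    rw [← hC.closure_eq]
    refine Metric.mem_closure_iff.2 fun ε hε => ?_
    have hε5 : 0 < ε / 5 := by positivity
    have h1 := hunif p (ε / 5) hε5
    have hopen : ∀ y, IsOpen {y' | dist (f p y') (f p y) < ε / 5} := fun y =>
      isOpen_lt ((hf p).dist continuous_const) continuous_const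
    have h2 := hlsc p _ (hopen z) ⟨z, hz, by simpa using hε5⟩
    obtain ⟨⟨p', x'⟩, ⟨-, hx'⟩, ⟨hp'1, z', hz'R, hz'⟩, hxd⟩ := hpx (_, _)
      ⟨h1.and h2, (hopen x).mem_nhds (by simpa using hε5)⟩
    refine ⟨_, hx' z' hz'R, ?_⟩
    have e1 : dist (f p' z') (f p z') ≤ ε / 5 := by rw [dist_eq_norm]; exact hp'1 z'
    have e2 : dist (f p' x') (f p x') ≤ ε / 5 := by rw [dist_eq_norm]; exact hp'1 x'
    have e3 : dist (f p z') (f p z) < ε / 5 := hz'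
    have e4 : dist (f p x') (f p x) < ε / 5 := hxd
    rw [dist_comm]
    calc dist (f p' z' - f p' x') (f p z - f p x)
        ≤ dist (f p' z') (f p z) + dist (f p' x') (f p x) := dist_sub_sub_le _ _ _ _
      _ < ε := by
        linarith [dist_triangle (f p' z') (f p z') (f p z),
          dist_triangle (f p' x') (f p x') (f p x)]

/-- Near an ideal efficient solution of the problem at `p₀`, nearby problems have feasible points
of arbitrarily small merit. -/
lemma eventually_exists_infDist_le {P E F : Type*} [TopologicalSpace P] [PseudoMetricSpace E]
    [NormedAddCommGroup F] {f : P → E → F} {R : P → Set E} {C : Set F}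
    (hf : ∀ p, Continuous (f p))
    (hunif : ∀ p₀ : P, ∀ ε : ℝ, 0 < ε → ∀ᶠ p in 𝓝 p₀, ∀ x, ‖f p x - f p₀ x‖ ≤ ε)
    (hlsc : LscSV R) (husc : UscSV R) {p₀ : P} {x₀ : E} (hx₀ : x₀ ∈ R p₀)
    (hid : ∀ z ∈ R p₀, f p₀ z - f p₀ x₀ ∈ C) {ε : ℝ} (hε : 0 < ε) :
    ∀ᶠ p in 𝓝 p₀, ∃ x ∈ R p, dist x x₀ ≤ ε ∧ ∀ z ∈ R p, infDist (f p z - f p x) C ≤ ε := by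
  have hε4 : 0 < ε / 4 := by positivity
  have hopen : IsOpen ({y | dist (f p₀ y) (f p₀ x₀) < ε / 4} ∩ Metric.ball x₀ ε) :=
    (isOpen_lt ((hf p₀).dist continuous_const) continuous_const).inter Metric.isOpen_ball
  have hopen' : IsOpen {z | infDist (f p₀ z - f p₀ x₀) C < ε / 4} :=
    isOpen_lt ((continuous_infDist_pt C).comp ((hf p₀).sub continuous_const)) continuous_const
  filter_upwards [hunif p₀ _ hε4,
    hlsc p₀ _ hopen ⟨x₀, hx₀, by simpa using hε4, Metric.mem_ball_self hε⟩,
    husc p₀ _ hopen' fun z hz => by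
      show infDist _ _ < _
      rw [infDist_zero_of_mem (hid z hz)]; exact hε4] with p h1 ⟨x, hxR, hx, hxb⟩ h3
  refine ⟨x, hxR, (Metric.mem_ball.1 hxb).le, fun z hz => ?_⟩
  have e1 : dist (f p z) (f p₀ z) ≤ ε / 4 := by rw [dist_eq_norm]; exact h1 z
  have e2 : dist (f p x) (f p₀ x) ≤ ε / 4 := by rw [dist_eq_norm]; exact h1 x
  have e3 : dist (f p₀ x) (f p₀ x₀) < ε / 4 := hx
  have e4 : infDist (f p₀ z - f p₀ x₀) C < ε / 4 := h3 hz
  have e5 : dist (f p z - f p x) (f p₀ z - f p₀ x₀) ≤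
      dist (f p z) (f p₀ z) + dist (f p x) (f p₀ x₀) := dist_sub_sub_le _ _ _ _
  linarith [infDist_le_infDist_add_dist (s := C) (x := f p z - f p x) (y := f p₀ z - f p₀ x₀),
    dist_triangle (f p x) (f p₀ x) (f p₀ x₀)]

/-- The set of ideal efficient points of a `C`-convex map over a convex set is convex. -/
lemma convex_setOf_ideal {E F : Type*} [AddCommGroup E] [Module ℝ E]
    [SeminormedAddCommGroup F] [NormedSpace ℝ F] {g : E → F} {S : Set E} {C : Set F}
    (hC : IsClosedConvexCone C) (hS : Convex ℝ S)
    (hg : ∀ x₁ x₂ : E, ∀ t : ℝ, t ∈ Icc (0 : ℝ) 1 →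
      t • g x₁ + (1 - t) • g x₂ - g (t • x₁ + (1 - t) • x₂) ∈ C) :
    Convex ℝ {x | x ∈ S ∧ ∀ z ∈ S, g z - g x ∈ C} := by
  intro x hx y hy a b ha hb hab
  refine ⟨hS hx.1 hy.1 ha hb hab, fun z hz => ?_⟩
  obtain rfl : b = 1 - a := by linarith
  have h := hC.add_mem_s17 (hC.2.1 (hx.2 z hz) (hy.2 z hz) ha hb hab) (hg x y a ⟨ha, by linarith⟩)
  convert h using 1
  module

lemma exists_infDist_sub_le {F : Type*} [NormedAddCommGroup F] {A C : Set F} (h0 : (0 : F) ∈ C)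
    (hA : Bornology.IsBounded (A \ C)) (y : F) :
    ∃ t : ℝ, 0 ≤ t ∧ ∀ v ∈ A, infDist (v - y) C ≤ t := by
  obtain ⟨M, hM⟩ := hA.exists_norm_le
  refine ⟨|M| + ‖y‖, by positivity, fun v hv => ?_⟩
  by_cases hvC : v ∈ C
  · refine (infDist_le_dist_of_mem hvC).trans ?_
    rw [dist_eq_norm, sub_sub_cancel_left, norm_neg]
    linarith [abs_nonneg M]
  · refine (infDist_le_dist_of_mem h0).trans ?_
    rw [dist_zero_right]
    linarith [norm_sub_le v y, hM v ⟨hv, hvC⟩, le_abs_self M]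

end Auxiliary

/-- Global continuous dependence of ideal efficient solutions on the parameter. -/
theorem stmt17 {P : Type*} [TopologicalSpace P] [ParacompactSpace P] {n m : ℕ}
    (f : P → EuclideanSpace ℝ (Fin n) → EuclideanSpace ℝ (Fin m))
    (R : P → Set (EuclideanSpace ℝ (Fin n)))
    (C : Set (EuclideanSpace ℝ (Fin m)))
    (hR : ∀ p, (R p).Nonempty ∧ IsClosed (R p))
    (hC : IsClosedConvexCone C) (hCpointed : C ∩ -C = {0})
    (hCne : ({0} : Set (EuclideanSpace ℝ (Fin m))) ≠ C) (hCpr : C ≠ Set.univ)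
    (hii : ∀ p, IsClosed (f p '' R p) ∧ Bornology.IsBounded (f p '' R p \ C))
    (hiii : 1 < alphaUnder f (fun _ => C) R)
    (ℓf : ℝ) (hℓfpos : 0 < ℓf)
    (hℓflt : ENNReal.ofReal ℓf < alphaUnder f (fun _ => C) R - 1)
    (hiv : ∀ p, Continuous (f p) ∧
      ∀ x₁ ∉ R p, ∀ x₂ ∉ R p, dist (f p x₁) (f p x₂) ≤ ℓf * dist x₁ x₂)
    (hv : ∀ p, ∀ x₁ x₂ : EuclideanSpace ℝ (Fin n), ∀ t : ℝ, t ∈ Set.Icc (0:ℝ) 1 →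
      t • f p x₁ + (1 - t) • f p x₂ - f p (t • x₁ + (1 - t) • x₂) ∈ C)
    (hvi : ∀ p₀ : P, ∀ ε : ℝ, 0 < ε → ∀ᶠ p in nhds p₀,
      ∀ x : EuclideanSpace ℝ (Fin n), ‖f p x - f p₀ x‖ ≤ ε)
    (hvii : LscSV R ∧ UscSV R ∧ ∀ p, Convex ℝ (R p)) :
    (∀ p, {x | x ∈ R p ∧ f p '' R p - {f p x} ⊆ C}.Nonempty) ∧
    ∃ ι : P → EuclideanSpace ℝ (Fin n), Continuous ι ∧
      ∀ p, ι p ∈ R p ∧ f p '' R p - {f p (ι p)} ⊆ C := by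
  have hlt : ENNReal.ofReal (1 + ℓf) < alphaUnder f (fun _ => C) R := by
    rw [ENNReal.ofReal_add zero_le_one hℓfpos.le, ENNReal.ofReal_one, add_comm]
    exact lt_tsub_iff_right.1 hℓflt
  obtain ⟨a, ha0, hla, haα⟩ := ENNReal.lt_iff_exists_real_btwn.1 hlt
  have hla' : 1 + ℓf < a := (ENNReal.ofReal_lt_ofReal_iff_of_nonneg (by positivity)).1 hla
  obtain ⟨hlsc, husc, hRconv⟩ := hvii
  set s := a - 1 - ℓf with hs
  have hspos : 0 < s := by linarith
  have herr : ∀ p, ∀ x₀ ∈ R p, ∀ t₀ : ℝ, 0 ≤ t₀ →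
      (∀ z ∈ R p, infDist (f p z - f p x₀) C ≤ t₀) →
      ∃ x ∈ R p, (∀ z ∈ R p, f p z - f p x ∈ C) ∧ s / 2 * dist x x₀ ≤ t₀ := by
    intro p x₀ hx₀ t₀ ht₀ hbd
    refine exists_ideal_of_decrease hC (hR p).2 (hiv p).1 (half_pos hspos) (half_lt_self hspos)
      (fun x hx hnot => ?_) hx₀ ht₀ hbd
    have hle : alphaUnder f (fun _ => C) R ≤ decBound (f p) C x :=
      iInf₂_le (p, x) ⟨hx, fun h => hnot (image_sub_singleton_subset_iff.1 h)⟩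
    obtain ⟨b, hb⟩ := lt_iSup_iff.1 (haα.trans_le hle)
    obtain ⟨hbinc, hab⟩ := lt_iSup_iff.1 hb
    exact exists_mem_decrease hC (hR p).2 (hiv p).1 hℓfpos.le (hiv p).2
      (ENNReal.ofReal_lt_ofReal_iff_of_nonneg ha0 |>.1 hab).le hx hbinc
  let I : P → Set (EuclideanSpace ℝ (Fin n)) := fun p =>
    {x | x ∈ R p ∧ ∀ z ∈ R p, f p z - f p x ∈ C}
  have hne : ∀ p, (I p).Nonempty := by
    intro p
    obtain ⟨x₀, hx₀⟩ := (hR p).1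
    obtain ⟨t, ht, hbd⟩ := exists_infDist_sub_le hC.2.2.1 (hii p).2 (f p x₀)
    obtain ⟨x, hx, hid, -⟩ := herr p x₀ hx₀ t ht fun z hz => hbd _ (mem_image_of_mem _ hz)
    exact ⟨x, hx, hid⟩
  have hIlsc : ∀ p, ∀ x ∈ I p, ∀ ε : ℝ, 0 < ε → ∀ᶠ p' in 𝓝 p, ∃ y ∈ I p', dist y x ≤ ε := by
    intro p x hx ε hε
    obtain ⟨η, hη, hηε, hηs⟩ : ∃ η : ℝ, 0 < η ∧ η ≤ ε / 2 ∧ η ≤ s / 2 * (ε / 2) :=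
      ⟨min (ε / 2) (s / 2 * (ε / 2)), lt_min (by positivity) (by positivity),
        min_le_left _ _, min_le_right _ _⟩
    filter_upwards [eventually_exists_infDist_le (fun p => (hiv p).1) hvi hlsc husc hx.1 hx.2 hη]
      with p' ⟨x', hx'R, hx'd, hx'⟩
    obtain ⟨y, hyR, hyid, hyd⟩ := herr p' x' hx'R η hη.le hx'
    have : dist y x' ≤ ε / 2 := le_of_mul_le_mul_left (hyd.trans hηs) (half_pos hspos)
    exact ⟨y, ⟨hyR, hyid⟩, (dist_triangle y x' x).trans (by linarith)⟩
  simp only [image_sub_singleton_subset_iff]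
  exact ⟨hne, exists_continuous_selection_of_isClosed_graph hne
    (fun p => convex_setOf_ideal hC (hRconv p) (hv p))
    (isClosed_graph_ideal hC.1 (fun p => (hR p).2) (fun p => (hiv p).1) hvi hlsc husc) hIlsc⟩
end

section
/- (Continuity of the ideal value) Let P be a paracompact topological space, f : P×ℝⁿ → ℝᵐ, R : P ⇉ ℝⁿ with nonempty closed values, and C ⊆ ℝᵐ a fixed pointed closed convex cone with {0} ≠ C ⊊ ℝᵐ, and suppose all the hypotheses (ii)–(vii) of the global continuous dependence theorem hold: f(p,R(p)) is closed and C-bounded for every p; α̲_{f,C,R} > 1; f(p,·) is continuous on ℝⁿ and Lipschitz continuous on ℝⁿ \ R(p) with constant ℓ_f ∈ (0, α̲_{f,C,R} − 1) uniform in p; f(p,·) is C-convex on ℝⁿ for every p; f(·,x) is continuous on P uniformly in x ∈ ℝⁿ; and R is continuous on P with convex values. Then there exists a continuous function v : P → ℝᵐ such that v(p) = f(p,x) for every p ∈ P and every x ∈ IE(p) = {x ∈ R(p) : f(p,R(p)) − f(p,x) ⊆ C}; i.e. the ideal value mapping p ↦ f(p, IE(p)) is single-valued and continuous on P. -/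
open Set Metric EMetric ENNReal Pointwise Filter Topology

/-- A proper closed convex cone has a unit vector in its dual cone. -/
lemma IsClosedConvexCone.exists_unit_dual {E : Type*} [NormedAddCommGroup E]
    [InnerProductSpace ℝ E] [CompleteSpace E] {C : Set E} (hC : IsClosedConvexCone C)
    (hne : C ≠ Set.univ) : ∃ e : E, ‖e‖ = 1 ∧ ∀ c ∈ C, 0 ≤ inner ℝ e c := by
  obtain ⟨hcl, hconv, h0, hcone⟩ := hC
  obtain ⟨z, hz⟩ := (Set.ne_univ_iff_exists_notMem C).1 hne
  obtain ⟨φ, s, hφ, hs⟩ := geometric_hahn_banach_closed_point hconv hcl hz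
  have hs0 : 0 < s := by simpa using hφ 0 h0
  have hneg : ∀ c ∈ C, φ c ≤ 0 := by
    intro c hc
    by_contra! hpos
    have h := hφ _ (hcone c hc (s / φ c) (by positivity))
    rw [map_smul, smul_eq_mul, div_mul_cancel₀ _ hpos.ne'] at h
    exact lt_irrefl _ h
  set d : E := (InnerProductSpace.toDual ℝ E).symm φ with hd
  have hdφ : ∀ y, inner ℝ d y = φ y := fun y => InnerProductSpace.toDual_symm_apply
  have hd0 : d ≠ 0 := by
    intro h
    have hz0 := hdφ z
    rw [h, inner_zero_left] at hz0
    linarith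
  have hdn : 0 < ‖d‖ := norm_pos_iff.2 hd0
  refine ⟨-(‖d‖⁻¹ • d), ?_, fun c hc => ?_⟩
  · rw [norm_neg, norm_smul, norm_inv, norm_norm, inv_mul_cancel₀ hdn.ne']
  · rw [inner_neg_left, real_inner_smul_left, hdφ]
    have := mul_nonneg (inv_nonneg.2 hdn.le) (neg_nonneg.2 (hneg c hc))
    linarith

/-- Closed pointed convex cones in a proper space are normal: a vector close to both `C` and `-C`
is small. -/
lemma IsClosedConvexCone.exists_normality_const {E : Type*} [NormedAddCommGroup E]
    [NormedSpace ℝ E] [ProperSpace E] {C : Set E} (hC : IsClosedConvexCone C)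
    (hp : C ∩ -C = {0}) :
    ∃ κ : ℝ, 0 < κ ∧ ∀ w b₁ b₂ : E, w + b₁ ∈ C → -w + b₂ ∈ C → κ * ‖w‖ ≤ ‖b₁‖ + ‖b₂‖ := by
  obtain ⟨hcl, -, h0, hcone⟩ := hC
  have hCn : C.Nonempty := ⟨0, h0⟩
  have hcont : ContinuousOn (fun w : E => infDist w C + infDist (-w) C) (sphere 0 1) := by
    have h := continuous_infDist_pt C
    exact (h.add (h.comp continuous_neg)).continuousOn
  have hpos : ∀ w ∈ sphere (0 : E) 1, 0 < infDist w C + infDist (-w) C := by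
    intro w hw
    have h1 := infDist_nonneg (x := w) (s := C)
    have h2 := infDist_nonneg (x := -w) (s := C)
    refine lt_of_le_of_ne (by positivity) fun h => ?_
    have hwC : w ∈ C := (hcl.mem_iff_infDist_zero hCn).2 (by linarith)
    have hwC' : -w ∈ C := (hcl.mem_iff_infDist_zero hCn).2 (by linarith)
    have : w ∈ C ∩ -C := ⟨hwC, hwC'⟩
    rw [hp, Set.mem_singleton_iff] at this
    simp [this] at hw
  obtain ⟨κ, hκ, hmin⟩ := (isCompact_sphere (0 : E) 1).exists_forall_le' hcont hpos
  refine ⟨κ, hκ, fun w b₁ b₂ h₁ h₂ => ?_⟩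
  rcases eq_or_ne w 0 with rfl | hw
  · simp only [norm_zero, mul_zero]; positivity
  have hwn : 0 < ‖w‖ := norm_pos_iff.2 hw
  have key : ∀ y b : E, y + b ∈ C → infDist (‖w‖⁻¹ • y) C ≤ ‖w‖⁻¹ * ‖b‖ := by
    intro y b h
    refine (infDist_le_dist_of_mem (hcone _ h ‖w‖⁻¹ (by positivity))).trans_eq ?_
    rw [dist_eq_norm, smul_add, sub_add_cancel_left, norm_neg, norm_smul, norm_inv, norm_norm]
  have h := hmin (‖w‖⁻¹ • w) (by
    rw [mem_sphere_zero_iff_norm, norm_smul, norm_inv, norm_norm, inv_mul_cancel₀ hwn.ne'])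
  have k₁ := key w b₁ h₁
  have k₂ := key (-w) b₂ h₂
  rw [smul_neg] at k₂
  have hle : κ ≤ ‖w‖⁻¹ * (‖b₁‖ + ‖b₂‖) := by linarith
  calc κ * ‖w‖ ≤ ‖w‖⁻¹ * (‖b₁‖ + ‖b₂‖) * ‖w‖ := by gcongr
    _ = ‖b₁‖ + ‖b₂‖ := by field_simp

/-- A continuous map that is Lipschitz off a closed set `S` moves by at most the Lipschitz constant
times the distance to `S` when passing to a nearest point of `S`. -/
lemma exists_nearest_dist_le {E F : Type*} [NormedAddCommGroup E] [NormedSpace ℝ E]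
    [ProperSpace E] [PseudoMetricSpace F] {g : E → F} {S : Set E} {ℓ : ℝ} (hℓ : 0 ≤ ℓ)
    (hS : IsClosed S) (hne : S.Nonempty) (hg : Continuous g)
    (hlip : ∀ x₁ ∉ S, ∀ x₂ ∉ S, dist (g x₁) (g x₂) ≤ ℓ * dist x₁ x₂) (u : E) :
    ∃ w ∈ S, dist u w = infDist u S ∧ dist (g u) (g w) ≤ ℓ * infDist u S := by
  obtain ⟨w, hwS, hw⟩ := hS.exists_infDist_eq_dist hne u
  refine ⟨w, hwS, hw.symm, ?_⟩
  by_cases hu : u ∈ S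
  · have h0 := infDist_zero_of_mem hu
    have : u = w := dist_le_zero.1 (by linarith)
    simp [this, infDist_zero_of_mem hwS]
  have hpos : 0 < dist u w := dist_pos.2 fun h => hu (h ▸ hwS)
  have hlim : Tendsto (fun t : ℝ => dist (g u) (g (AffineMap.lineMap w u t))) (𝓝[>] 0)
      (𝓝 (dist (g u) (g w))) := by
    have hc : Continuous fun t : ℝ => dist (g u) (g (AffineMap.lineMap w u t)) :=
      continuous_const.dist (hg.comp AffineMap.lineMap_continuous)
    have := hc.tendsto 0
    rw [AffineMap.lineMap_apply_zero] at this
    exact this.mono_left nhdsWithin_le_nhds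
  refine le_of_tendsto hlim ?_
  filter_upwards [Ioo_mem_nhdsGT (zero_lt_one' ℝ)] with t ht
  have hd : dist u (AffineMap.lineMap w u t) = (1 - t) * dist u w := by
    rw [dist_right_lineMap, Real.norm_of_nonneg (by linarith [ht.2]), dist_comm]
  have hnot : AffineMap.lineMap w u t ∉ S := by
    intro h
    have := infDist_le_dist_of_mem (x := u) h
    rw [hd, hw] at this
    nlinarith [ht.1]
  refine (hlip u hu _ hnot).trans ?_
  rw [hd, hw]
  gcongr
  nlinarith [ht.1]

/-- A bound of metric `C`-decrease forces a decrease along each unit vector of the dual cone. -/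
lemma exists_inner_le_of_isIncBoundAt {X E : Type*} [PseudoMetricSpace X] [NormedAddCommGroup E]
    [InnerProductSpace ℝ E] [ProperSpace E] {g : X → E} {C : Set E} {x : X} {a : ℝ}
    (hC : IsClosed C) {e : E} (he : ‖e‖ = 1) (heC : ∀ c ∈ C, 0 ≤ inner ℝ e c)
    (h : IsIncBoundAt (fun x => ({-g x} : Set E)) C x a) :
    ∃ r : ℝ, 0 < r ∧ ∃ u, dist u x ≤ r ∧ inner ℝ e (g u) ≤ inner ℝ e (g x) - (a - 1) * r := by
  obtain ⟨ha, r, hr, hδ⟩ := h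
  obtain ⟨u, hu, hsub⟩ := hδ r hr le_rfl
  refine ⟨r, hr, u, hu, ?_⟩
  have hcl : IsClosed (({-g x} : Set E) + C) := by
    rw [Set.singleton_add]
    exact (Homeomorph.addLeft (-g x)).isClosedMap _ hC
  rw [cthickening_singleton _ (by nlinarith), hcl.cthickening_eq_biUnion_closedBall hr.le] at hsub
  have hmem : -g u - (a * r) • e ∈ closedBall (-g u) (a * r) := by
    rw [Metric.mem_closedBall, dist_eq_norm, sub_sub_cancel_left, norm_neg, norm_smul, he, mul_one,
      Real.norm_of_nonneg (by nlinarith)]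
  obtain ⟨y, hy, hdist⟩ := Set.mem_iUnion₂.1 (hsub hmem)
  rw [Set.singleton_add] at hy
  obtain ⟨c, hc, rfl⟩ := hy
  rw [Metric.mem_closedBall, dist_eq_norm] at hdist
  have habs : |inner ℝ e (-g u - (a * r) • e - (-g x + c))| ≤ r :=
    (abs_real_inner_le_norm _ _).trans (by rwa [he, one_mul])
  have hcs := abs_le.1 habs
  have hc0 := heC c hc
  have hee : inner ℝ e e = (1 : ℝ) := by rw [real_inner_self_eq_norm_sq, he]; norm_num
  simp only [inner_sub_right, inner_add_right, inner_neg_right, real_inner_smul_right, hee] at hcs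
  linarith [hcs.1]

/-- A continuous function bounded below on a closed set `S` of a proper space cannot be decreased
at a uniform linear rate from every point of `S`. -/
lemma exists_forall_le_add_mul_dist {X : Type*} [MetricSpace X] [ProperSpace X]
    {S : Set X} (hS : IsClosed S) (hne : S.Nonempty) {g : X → ℝ} (hg : ContinuousOn g S) {M : ℝ}
    (hM : ∀ x ∈ S, M ≤ g x) {ε : ℝ} (hε : 0 < ε) :
    ∃ x ∈ S, ∀ y ∈ S, g x ≤ g y + ε * dist y x := by
  obtain ⟨x₀, hx₀⟩ := hne
  have hcont : ContinuousOn (fun x => g x + ε * dist x x₀) S :=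
    hg.add (by fun_prop)
  obtain ⟨x, hx, hmin⟩ := hcont.exists_isMinOn' hS hx₀ (by
    have h := (tendsto_dist_right_cocompact_atTop x₀).eventually_ge_atTop ((g x₀ - M) / ε)
    filter_upwards [h.filter_mono inf_le_left, mem_inf_of_right (mem_principal_self S)]
      with y hy hyS
    rw [div_le_iff₀ hε] at hy
    simp only [dist_self, mul_zero, add_zero]
    linarith [hM y hyS])
  refine ⟨x, hx, fun y hy => ?_⟩
  have h : g x + ε * dist x x₀ ≤ g y + ε * dist y x₀ := hmin hy
  nlinarith [dist_triangle y x x₀]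

/-- Existence of ideal efficient points under a uniform bound of `C`-decrease. -/
lemma exists_ideal_point {X E : Type*} [NormedAddCommGroup X] [NormedSpace ℝ X] [ProperSpace X]
    [NormedAddCommGroup E] [InnerProductSpace ℝ E] [ProperSpace E] {g : X → E} {S : Set X}
    {C : Set E} (hS : IsClosed S) (hne : S.Nonempty) (hC : IsClosedConvexCone C)
    (hCpr : C ≠ Set.univ) (hb : Bornology.IsBounded (g '' S \ C)) {ℓ γ : ℝ} (hℓ : 0 ≤ ℓ)
    (hγ : 1 + ℓ < γ) (hg : Continuous g)
    (hlip : ∀ x₁ ∉ S, ∀ x₂ ∉ S, dist (g x₁) (g x₂) ≤ ℓ * dist x₁ x₂)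
    (hdec : ∀ x ∈ S, ¬ (g '' S - {g x} ⊆ C) →
      ∃ a, γ ≤ a ∧ IsIncBoundAt (fun x => ({-g x} : Set E)) C x a) :
    ∃ x ∈ S, g '' S - {g x} ⊆ C := by
  obtain ⟨e, he, heC⟩ := hC.exists_unit_dual hCpr
  obtain ⟨M, hM⟩ := hb.exists_norm_le
  have hbelow : ∀ x ∈ S, -|M| ≤ inner ℝ e (g x) := by
    intro x hx
    by_cases hxC : g x ∈ C
    · linarith [heC _ hxC, abs_nonneg M]
    · have h1 := hM _ ⟨Set.mem_image_of_mem g hx, hxC⟩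
      have h2 := abs_le.1 (abs_real_inner_le_norm e (g x))
      rw [he, one_mul] at h2
      linarith [h2.1, le_abs_self M]
  set β : ℝ := γ - 1 - ℓ with hβ
  have hβ0 : 0 < β := by linarith
  obtain ⟨x, hx, hmin⟩ := exists_forall_le_add_mul_dist hS hne
    (g := fun x => inner ℝ e (g x)) (by fun_prop) hbelow (ε := β / 4) (by positivity)
  refine ⟨x, hx, ?_⟩
  by_contra hnot
  obtain ⟨a, hγa, ha⟩ := hdec x hx hnot
  obtain ⟨r, hr, u, hux, hu⟩ := exists_inner_le_of_isIncBoundAt hC.1 he heC ha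
  obtain ⟨w, hwS, huw, hgw⟩ := exists_nearest_dist_le hℓ hS hne hg hlip u
  have hir : infDist u S ≤ r := (infDist_le_dist_of_mem hx).trans hux
  have hwx : dist w x ≤ 2 * r := by
    have := dist_triangle w u x
    rw [dist_comm w u] at this
    linarith
  have hgr : ‖g w - g u‖ ≤ ℓ * r := by
    rw [← dist_eq_norm, dist_comm]
    exact hgw.trans (by gcongr)
  have hin := abs_le.1 (abs_real_inner_le_norm e (g w - g u))
  rw [he, one_mul, inner_sub_right] at hin
  have h := hmin w hwS
  have h1 : β / 4 * dist w x ≤ β / 4 * (2 * r) := by gcongr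
  have h2 : (γ - 1) * r ≤ (a - 1) * r := by gcongr
  have h3 : β * r = (γ - 1) * r - ℓ * r := by rw [hβ]; ring
  have h4 : 0 < β * r := by positivity
  linarith [hin.2]

/-- Continuity of the ideal value mapping of a parameterized vector optimization
problem. -/
theorem stmt18 {P : Type*} [TopologicalSpace P] [ParacompactSpace P] {n m : ℕ}
    (f : P → EuclideanSpace ℝ (Fin n) → EuclideanSpace ℝ (Fin m))
    (R : P → Set (EuclideanSpace ℝ (Fin n)))
    (C : Set (EuclideanSpace ℝ (Fin m)))
    (hR : ∀ p, (R p).Nonempty ∧ IsClosed (R p))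
    (hC : IsClosedConvexCone C) (hCpointed : C ∩ -C = {0})
    (hCne : ({0} : Set (EuclideanSpace ℝ (Fin m))) ≠ C) (hCpr : C ≠ Set.univ)
    (hii : ∀ p, IsClosed (f p '' R p) ∧ Bornology.IsBounded (f p '' R p \ C))
    (hiii : 1 < alphaUnder f (fun _ => C) R)
    (ℓf : ℝ) (hℓfpos : 0 < ℓf)
    (hℓflt : ENNReal.ofReal ℓf < alphaUnder f (fun _ => C) R - 1)
    (hiv : ∀ p, Continuous (f p) ∧
      ∀ x₁ ∉ R p, ∀ x₂ ∉ R p, dist (f p x₁) (f p x₂) ≤ ℓf * dist x₁ x₂)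
    (hv : ∀ p, ∀ x₁ x₂ : EuclideanSpace ℝ (Fin n), ∀ t : ℝ, t ∈ Set.Icc (0:ℝ) 1 →
      t • f p x₁ + (1 - t) • f p x₂ - f p (t • x₁ + (1 - t) • x₂) ∈ C)
    (hvi : ∀ p₀ : P, ∀ ε : ℝ, 0 < ε → ∀ᶠ p in nhds p₀,
      ∀ x : EuclideanSpace ℝ (Fin n), ‖f p x - f p₀ x‖ ≤ ε)
    (hvii : LscSV R ∧ UscSV R ∧ ∀ p, Convex ℝ (R p)) :
    ∃ v : P → EuclideanSpace ℝ (Fin m), Continuous v ∧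
      ∀ p, ∀ x, x ∈ R p → f p '' R p - {f p x} ⊆ C → v p = f p x := by
  obtain ⟨γ, hγ, hγα⟩ : ∃ γ : ℝ, 1 + ℓf < γ ∧ ENNReal.ofReal γ < alphaUnder f (fun _ => C) R := by
    have h : 1 + ENNReal.ofReal ℓf < alphaUnder f (fun _ => C) R := by
      rw [add_comm]; exact lt_tsub_iff_right.1 hℓflt
    obtain ⟨q, hq0, hq, hqα⟩ := ENNReal.lt_iff_exists_real_btwn.1 h
    refine ⟨q, ?_, hqα⟩
    rw [← ENNReal.ofReal_one, ← ENNReal.ofReal_add zero_le_one hℓfpos.le] at hq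
    exact (ENNReal.ofReal_lt_ofReal_iff_of_nonneg (by positivity)).1 hq
  have hideal : ∀ p, ∃ x ∈ R p, f p '' R p - {f p x} ⊆ C := by
    intro p
    refine exists_ideal_point (hR p).2 (hR p).1 hC hCpr (hii p).2 hℓfpos.le hγ (hiv p).1
      (hiv p).2 fun x hx hnot => ?_
    have hlt : ENNReal.ofReal γ < decBound (f p) C x :=
      hγα.trans_le (iInf₂_le (p, x) ⟨hx, hnot⟩)
    obtain ⟨a, ha⟩ := lt_iSup_iff.1 hlt
    obtain ⟨ha', hlt'⟩ := lt_iSup_iff.1 ha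
    exact ⟨a, (ENNReal.ofReal_lt_ofReal_iff_of_nonneg (by linarith)).1 hlt' |>.le, ha'⟩
  have hle : ∀ p x, f p '' R p - {f p x} ⊆ C → ∀ y ∈ R p, f p y - f p x ∈ C :=
    fun p x hx y hy => hx (Set.sub_mem_sub (Set.mem_image_of_mem _ hy) rfl)
  choose ξ hξR hξ using hideal
  refine ⟨fun p => f p (ξ p), ?_, fun p x hx hxi => ?_⟩
  · obtain ⟨κ, hκ, hnorm⟩ := hC.exists_normality_const hCpointed
    refine continuous_iff_continuousAt.2 fun p₀ => Metric.tendsto_nhds.2 fun ε hε => ?_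
    set η : ℝ := κ * ε / (4 + ℓf) / 2 with hη
    have hη0 : 0 < η := by positivity
    have hηε : (3 + ℓf) * η < κ * ε := by
      have : (4 + ℓf) * (2 * η) = κ * ε := by rw [hη]; field_simp
      nlinarith
    have hopen : IsOpen (ball (ξ p₀) η ∩ f p₀ ⁻¹' ball (f p₀ (ξ p₀)) η) :=
      Metric.isOpen_ball.inter (Metric.isOpen_ball.preimage (hiv p₀).1)
    filter_upwards [hvi p₀ η hη0,
      hvii.1 p₀ _ hopen ⟨ξ p₀, hξR p₀, Metric.mem_ball_self hη0, Metric.mem_ball_self hη0⟩,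
      hvii.2.1 p₀ _ isOpen_thickening (self_subset_thickening hη0 (R p₀))] with p hp hlsc husc
    obtain ⟨y, hyR, -, hy⟩ := hlsc
    rw [Set.mem_preimage, Metric.mem_ball, dist_eq_norm] at hy
    obtain ⟨z, hzR, -, hz⟩ := exists_nearest_dist_le hℓfpos.le (hR p₀).2 (hR p₀).1 (hiv p₀).1
      (hiv p₀).2 (ξ p)
    have hzη : dist (f p₀ (ξ p)) (f p₀ z) ≤ ℓf * η := by
      refine hz.trans ?_
      gcongr
      exact ((mem_thickening_iff_infDist_lt (hR p₀).1).1 (husc (hξR p))).le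
    rw [dist_eq_norm, norm_sub_rev] at hzη
    have hmain := hnorm (f p (ξ p) - f p₀ (ξ p₀))
      (f p₀ z - f p₀ (ξ p) - (f p (ξ p) - f p₀ (ξ p)))
      (f p y - f p₀ y + (f p₀ y - f p₀ (ξ p₀)))
      (by convert hle p₀ _ (hξ p₀) z hzR using 1; abel)
      (by convert hle p _ (hξ p) y hyR using 1; abel)
    have h1 := norm_sub_le (f p₀ z - f p₀ (ξ p)) (f p (ξ p) - f p₀ (ξ p))
    have h2 := norm_add_le (f p y - f p₀ y) (f p₀ y - f p₀ (ξ p₀))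
    rw [dist_eq_norm]
    refine lt_of_mul_lt_mul_left ?_ hκ.le
    linarith [hp (ξ p), hp y]
  · have hmem : f p (ξ p) - f p x ∈ C ∩ -C := by
      refine ⟨hle p x hxi _ (hξR p), ?_⟩
      rw [Set.mem_neg, neg_sub]
      exact hle p _ (hξ p) x hx
    rw [hCpointed, Set.mem_singleton_iff] at hmem
    exact sub_eq_zero.1 hmem
end

section
/- Let φ : ℝ → ℝ be any continuous function and define f : ℝ×ℝ → ℝ² by f(p,x) = (|x−φ(p)|, |x−φ(p)|), where ℝ² carries the Euclidean norm. Then for every p ∈ ℝ, every x ∈ ℝ with x ≠ φ(p), and every r ∈ (0, |x−φ(p)|/2], there exists u ∈ ℝ with |u−x| ≤ r (namely u = x−r if x > φ(p) and u = x+r if x < φ(p)) such that B(f(p,u), 2r) ⊆ B(f(p,x) − ℝ²₊, r). Consequently, f(p,·) is ℝ²₊-decreasing at every x ≠ φ(p) with dec(f(p,·), ℝ²₊, x) ≥ 2. -/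
open Set Metric EMetric ENNReal Pointwise Filter Topology

/-- The objective `f(p,x) = (|x−φ(p)|, |x−φ(p)|)` of the example. -/
noncomputable def f19 (φ : ℝ → ℝ) (p x : ℝ) : EuclideanSpace ℝ (Fin 2) :=
  (WithLp.equiv 2 (Fin 2 → ℝ)).symm ![|x - φ p|, |x - φ p|]

/-- Points within `2r` of `f(p,u)` are within `r` of `f(p,x) − ℝ²₊` when
`|u − φ(p)| = |x − φ(p)| − r`. -/
theorem exists_mem_pos2_dist_sub_le (φ : ℝ → ℝ) {p x u r : ℝ} (hr : 0 < r)
    (hu : |u - φ p| = |x - φ p| - r) {y : EuclideanSpace ℝ (Fin 2)}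
    (hy : dist y (f19 φ p u) ≤ 2 * r) : ∃ w ∈ pos2, dist y (f19 φ p x - w) ≤ r := by
  set d := |x - φ p| with hd
  have hu0 : f19 φ p u 0 = d - r := by simp [f19, hu]
  have hu1 : f19 φ p u 1 = d - r := by simp [f19, hu]
  have hx0 : f19 φ p x 0 = d := by simp [f19, hd]
  have hx1 : f19 φ p x 1 = d := by simp [f19, hd]
  rw [EuclideanSpace.dist_eq, Real.sqrt_le_left (by positivity)] at hy
  simp only [Fin.sum_univ_two, Real.dist_eq, sq_abs, hu0, hu1] at hy
  refine ⟨!₂[d - min (y 0) d, d - min (y 1) d], by simp [pos2], ?_⟩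
  rw [EuclideanSpace.dist_eq, Real.sqrt_le_left hr.le]
  simp only [Fin.sum_univ_two, Real.dist_eq, sq_abs, PiLp.sub_apply, hx0, hx1]
  simp only [Matrix.cons_val_zero, Matrix.cons_val_one]
  generalize y 0 = a at *
  generalize y 1 = b at *
  have coord {t : ℝ} (ht : (t - (d - r)) ^ 2 ≤ (2 * r) ^ 2) : t - d ≤ r := by
    linarith [le_of_sq_le_sq ht (by positivity)]
  have ha : a - d ≤ r := coord (by nlinarith [sq_nonneg (b - (d - r))])
  have hb : b - d ≤ r := coord (by nlinarith [sq_nonneg (a - (d - r))])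
  rcases le_total a d with h₁ | h₁ <;> rcases le_total b d with h₂ | h₂ <;>
    simp only [min_eq_left, min_eq_right, h₁, h₂, sub_self] <;> nlinarith

/-- Moving from `x` towards `φ(p)` by `r` lowers `|x − φ(p)|` by `r`. -/
theorem exists_abs_sub_eq_sub {c x r : ℝ} (hr : 0 < r) (hrx : r ≤ |x - c| / 2) :
    ∃ u : ℝ, (c < x → u = x - r) ∧ (x < c → u = x + r) ∧ |u - x| ≤ r ∧
      |u - c| = |x - c| - r := by
  rcases le_total x c with h | h
  · rw [abs_of_nonpos (sub_nonpos.2 h)] at hrx ⊢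
    refine ⟨x + r, fun h' => absurd h h'.not_ge, fun _ => rfl, ?_, ?_⟩
    · simp [abs_of_pos hr]
    · rw [abs_of_nonpos] <;> linarith
  · rw [abs_of_nonneg (sub_nonneg.2 h)] at hrx ⊢
    refine ⟨x - r, fun _ => rfl, fun h' => absurd h h'.not_ge, ?_, ?_⟩
    · simp [abs_of_pos hr]
    · rw [abs_of_nonneg] <;> linarith

/-- `2` is an admissible bound of decrease of `f(p,·)` at every `x ≠ φ(p)`. -/
theorem isIncBoundAt_neg_f19_two (φ : ℝ → ℝ) {p x : ℝ} (hx : x ≠ φ p) :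
    IsIncBoundAt (fun x => ({-f19 φ p x} : Set (EuclideanSpace ℝ (Fin 2)))) pos2 x 2 := by
  refine ⟨one_lt_two, |x - φ p| / 2, half_pos (abs_pos.2 (sub_ne_zero.2 hx)),
    fun r hr hrx => ?_⟩
  obtain ⟨u, -, -, hux, hu⟩ := exists_abs_sub_eq_sub hr hrx
  refine ⟨u, by rwa [Metric.mem_closedBall, Real.dist_eq], fun y hy => ?_⟩
  rw [Metric.cthickening_singleton _ (by positivity), Metric.mem_closedBall] at hy
  obtain ⟨w, hw, hyw⟩ := exists_mem_pos2_dist_sub_le φ hr hu (y := -y)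
    (by rwa [← dist_neg_neg, neg_neg])
  refine Metric.mem_cthickening_of_dist_le y (-f19 φ p x + w) r _
    (Set.add_mem_add rfl hw) ?_
  rwa [← dist_neg_neg, neg_add, neg_neg, ← sub_eq_add_neg]

/-- The map `x ↦ (|x−φ(p)|,|x−φ(p)|)` is `ℝ²₊`-decreasing at every `x ≠ φ(p)` with
exact bound of decrease at least `2`. -/
theorem stmt19 (φ : ℝ → ℝ) (hφ : Continuous φ) :
    (∀ p x : ℝ, x ≠ φ p → ∀ r : ℝ, 0 < r → r ≤ |x - φ p| / 2 →
      ∃ u : ℝ,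
        (φ p < x → u = x - r) ∧ (x < φ p → u = x + r) ∧ |u - x| ≤ r ∧
        Metric.cthickening (2 * r) ({f19 φ p u} : Set (EuclideanSpace ℝ (Fin 2))) ⊆
          Metric.cthickening r ({f19 φ p x} - pos2)) ∧
    ∀ p x : ℝ, x ≠ φ p →
      CDecreasingAt (f19 φ p) pos2 x ∧ (2 : ℝ≥0∞) ≤ decBound (f19 φ p) pos2 x := by
  refine ⟨fun p x _ r hr hrx => ?_, fun p x hx => ?_⟩
  · obtain ⟨u, h₁, h₂, hux, hu⟩ := exists_abs_sub_eq_sub hr hrx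
    refine ⟨u, h₁, h₂, hux, fun y hy => ?_⟩
    rw [Metric.cthickening_singleton _ (by positivity), Metric.mem_closedBall] at hy
    obtain ⟨w, hw, hyw⟩ := exists_mem_pos2_dist_sub_le φ hr hu hy
    exact Metric.mem_cthickening_of_dist_le y _ r _ (Set.sub_mem_sub rfl hw) hyw
  · have h := isIncBoundAt_neg_f19_two φ hx
    refine ⟨⟨2, h⟩, ?_⟩
    exact (ENNReal.ofReal_ofNat 2).ge.trans
      (le_iSup₂_of_le (f := fun a _ => ENNReal.ofReal a) 2 h le_rfl)
end
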